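/- arXiv:2401.06939 — 2 statements merged into one kernel-verified Lean document; each statement's English description precedes it below -/
import Mathlib

section
/- (Minimum principle barrier) Let f : [0,T]×ℝ³ → [0,∞) be a smooth, rapidly decaying solution of the Landau–Coulomb equation such that ‖A[f](t)‖_{L^∞} ≤ M t^{−1/3} for all t ∈ (0,T]. Then for each a > 0 and k > 0 there exists n₀ < −3 (depending on k) such that for every n ≤ n₀ there is η = η(n,k,M) > 0 with d/dt ∫_{ℝ³} ⟨v⟩^n (a e^{−η t^{2/3}} − f(t,v)⟨v⟩^k)₊^{3/2} dv ≤ 0 for all t ∈ (0,T). -/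
open MeasureTheory Real
noncomputable section

/-- Velocity space `ℝ³`. -/
abbrev V3 : Type := EuclideanSpace ℝ (Fin 3)

/-- Japanese bracket `⟨v⟩ = (1 + |v|²)^{1/2}`. -/
def jap (v : V3) : ℝ := Real.sqrt (1 + ‖v‖ ^ 2)

/-- Positive part `x₊ = max(x,0)`. -/
def plus (x : ℝ) : ℝ := max x 0

/-- Partial derivative in the `i`-th coordinate direction. -/
def pd (i : Fin 3) (F : V3 → ℝ) (v : V3) : ℝ :=
  fderiv ℝ F v (EuclideanSpace.single i 1)

/-- The Landau-Coulomb diffusion matrix `A[g]`. -/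
def Amat (g : V3 → ℝ) (v : V3) : Matrix (Fin 3) (Fin 3) ℝ := fun i j =>
  ∫ w : V3, g w * (((if i = j then (1 : ℝ) else 0) -
      (v - w) i * (v - w) j / ‖v - w‖ ^ 2) / (8 * π * ‖v - w‖))

/-- The Coulomb potential `a[g]`. -/
def apot (g : V3 → ℝ) (v : V3) : ℝ := ∫ w : V3, g w / (4 * π * ‖v - w‖)

/-- Right-hand side `∇·(A[g]∇g − ∇a[g] g)` of the Landau equation. -/
def landauRHS (g : V3 → ℝ) (v : V3) : ℝ :=
  ∑ i : Fin 3, pd i (fun u =>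
    (∑ j : Fin 3, Amat g u i j * pd j g u) - pd i (apot g) u * g u) v

/-- `f` solves the Landau equation pointwise at every time in `s`. -/
def SolvesLandauOn (s : Set ℝ) (f : ℝ → V3 → ℝ) : Prop :=
  ∀ t ∈ s, ∀ v : V3, HasDerivAt (fun τ => f τ v) (landauRHS (f t) v) t

/-- A smooth, rapidly decaying (Schwartz-class in `v`) nonnegative solution on the
time set `s`, solving the equation pointwise on the interior of `s`. -/
structure SmoothRapidSolutionOn (s : Set ℝ) (f : ℝ → V3 → ℝ) : Prop where
  nonneg : ∀ t ∈ s, ∀ v : V3, 0 ≤ f t v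
  smooth : ContDiffOn ℝ (⊤ : ℕ∞) (fun q : ℝ × V3 => f q.1 q.2) (s ×ˢ (Set.univ : Set V3))
  schwartz : ∀ t ∈ s, ∃ φ : SchwartzMap V3 ℝ, ∀ v, f t v = φ v
  solves : SolvesLandauOn (interior s) f

/-- Normalization: unit mass, zero mean velocity, temperature `3`. -/
def Normalized (g : V3 → ℝ) : Prop :=
  (∫ v : V3, g v) = 1 ∧ (∀ i : Fin 3, (∫ v : V3, v i * g v) = 0) ∧
    (∫ v : V3, ‖v‖ ^ 2 * g v) = 3

/-- `c • Id ≤ M` as quadratic forms. -/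
def matGE (c : ℝ) (M : Matrix (Fin 3) (Fin 3) ℝ) : Prop :=
  ∀ ξ : Fin 3 → ℝ, c * ∑ i, ξ i ^ 2 ≤ ∑ i, ∑ j, M i j * ξ i * ξ j

/-- `M ≤ c • Id` as quadratic forms. -/
def matLE (M : Matrix (Fin 3) (Fin 3) ℝ) (c : ℝ) : Prop :=
  ∀ ξ : Fin 3 → ℝ, (∑ i, ∑ j, M i j * ξ i * ξ j) ≤ c * ∑ i, ξ i ^ 2

/-- `‖A[g]‖_{L^∞}`: sup over `v` of the operator norm of `A[g](v)`. -/
def AinfNorm (g : V3 → ℝ) : ℝ :=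
  ⨆ v : V3, ‖Matrix.toEuclideanCLM (𝕜 := ℝ) (Amat g v)‖

/-- Fisher information (with the convention `x/0 = 0`). -/
def fisher (g : V3 → ℝ) : ℝ := ∫ v : V3, ‖gradient g v‖ ^ 2 / g v

namespace MPB

lemma pd_mul {F G : V3 → ℝ} {v : V3} (i : Fin 3) (hF : DifferentiableAt ℝ F v)
    (hG : DifferentiableAt ℝ G v) :
    pd i (fun u => F u * G u) v = F v * pd i G v + pd i F v * G v := by
  unfold pd
  rw [fderiv_fun_mul hF hG]
  simp [mul_comm]

lemma pd_add {F G : V3 → ℝ} {v : V3} (i : Fin 3) (hF : DifferentiableAt ℝ F v)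
    (hG : DifferentiableAt ℝ G v) :
    pd i (fun u => F u + G u) v = pd i F v + pd i G v := by
  unfold pd
  rw [fderiv_fun_add hF hG]; simp

lemma pd_sub {F G : V3 → ℝ} {v : V3} (i : Fin 3) (hF : DifferentiableAt ℝ F v)
    (hG : DifferentiableAt ℝ G v) :
    pd i (fun u => F u - G u) v = pd i F v - pd i G v := by
  unfold pd
  rw [fderiv_fun_sub hF hG]; simp

lemma pd_const_sub {F : V3 → ℝ} {v : V3} (i : Fin 3) (c : ℝ) :
    pd i (fun u => c - F u) v = - pd i F v := by
  unfold pd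
  rw [fderiv_const_sub]; simp

lemma pd_neg {F : V3 → ℝ} {v : V3} (i : Fin 3) :
    pd i (fun u => - F u) v = - pd i F v := by
  unfold pd
  rw [fderiv_fun_neg]; simp

lemma pd_const_mul {F : V3 → ℝ} {v : V3} (i : Fin 3) (c : ℝ) (hF : DifferentiableAt ℝ F v) :
    pd i (fun u => c * F u) v = c * pd i F v := by
  unfold pd
  rw [fderiv_const_mul hF]; simp

lemma pd_sum {ι : Type} (s : Finset ι) {F : ι → V3 → ℝ} {v : V3} (i : Fin 3)
    (hF : ∀ j ∈ s, DifferentiableAt ℝ (F j) v) :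
    pd i (fun u => ∑ j ∈ s, F j u) v = ∑ j ∈ s, pd i (F j) v := by
  unfold pd
  rw [fderiv_fun_sum hF]; simp

lemma pd_comp {β : ℝ → ℝ} {β' : ℝ} {F : V3 → ℝ} {v : V3} (i : Fin 3)
    (hβ : HasDerivAt β β' (F v)) (hF : DifferentiableAt ℝ F v) :
    pd i (fun u => β (F u)) v = β' * pd i F v := by
  unfold pd
  have := (hβ.comp_hasFDerivAt v hF.hasFDerivAt).fderiv
  rw [show (fun u => β (F u)) = β ∘ F from rfl, this]; simp

lemma pd_coord (i j : Fin 3) (v : V3) : pd i (fun u : V3 => u j) v = if i = j then 1 else 0 := by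
  unfold pd
  have : (fun u : V3 => u j) = (EuclideanSpace.proj j : V3 →L[ℝ] ℝ) := by ext; simp
  rw [this, ContinuousLinearMap.fderiv]
  simp [PiLp.single_apply, eq_comm]

lemma contDiff_pd {F : V3 → ℝ} {n : ℕ} (i : Fin 3) (hF : ContDiff ℝ (n + 1 : ℕ) F) :
    ContDiff ℝ n (pd i F) := by
  have h : ContDiff ℝ n (fderiv ℝ F) := hF.fderiv_right (by norm_cast)
  exact h.clm_apply contDiff_const

lemma contDiff_coord (j : Fin 3) {n : WithTop ℕ∞} : ContDiff ℝ n (fun u : V3 => u j) :=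
  (EuclideanSpace.proj j : V3 →L[ℝ] ℝ).contDiff

lemma pd_hcs {F : V3 → ℝ} (i : Fin 3) (hF : HasCompactSupport F) : HasCompactSupport (pd i F) :=
  hF.fderiv_apply ℝ _

lemma ibp {F G : V3 → ℝ} (i : Fin 3) (hF : ContDiff ℝ 1 F) (hG : ContDiff ℝ 1 G)
    (hs : HasCompactSupport F) :
    ∫ v, F v * pd i G v = - ∫ v, pd i F v * G v := by
  have cF := hF.continuous
  have cG := hG.continuous
  have cF' : Continuous (pd i F) := (contDiff_pd (n := 0) i hF).continuous
  have cG' : Continuous (pd i G) := (contDiff_pd (n := 0) i hG).continuous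
  refine integral_mul_fderiv_eq_neg_fderiv_mul_of_integrable ?_ ?_ ?_ ?_ ?_
  · exact (cF'.mul cG).integrable_of_hasCompactSupport ((pd_hcs i hs).mul_right)
  · exact (cF.mul cG').integrable_of_hasCompactSupport (hs.mul_right)
  · exact (cF.mul cG).integrable_of_hasCompactSupport (hs.mul_right)
  · exact fun x _ => (hF.differentiable one_ne_zero) x
  · exact fun x _ => (hG.differentiable one_ne_zero) x

lemma isum2 {F : Fin 3 → Fin 3 → V3 → ℝ} (hF : ∀ i j, Integrable (F i j)) :
    ∫ v, ∑ i, ∑ j, F i j v = ∑ i, ∑ j, ∫ v, F i j v := by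
  rw [integral_finsetSum _ fun i _ => integrable_finsetSum _ fun j _ => hF i j]
  exact Finset.sum_congr rfl fun i _ => integral_finsetSum _ fun j _ => hF i j

/-- The structural properties of the diffusion matrix and the potential used in the proof. -/
structure Good (A : V3 → Matrix (Fin 3) (Fin 3) ℝ) (α : V3 → ℝ) : Prop where
  cA : ∀ i j, ContDiff ℝ 1 (fun v => A v i j)
  sym : ∀ v i j, A v i j = A v j i
  psd : ∀ v (ξ : Fin 3 → ℝ), 0 ≤ ∑ i, ∑ j, A v i j * ξ i * ξ j
  cα : ContDiff ℝ 2 α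
  div : ∀ j v, ∑ i, pd i (fun u => A u i j) v = pd j α v
  lap : ∀ v, ∑ i, pd i (pd i α) v ≤ 0

lemma ibp_core {A : V3 → Matrix (Fin 3) (Fin 3) ℝ} {α : V3 → ℝ} (H : Good A α)
    {ω h : V3 → ℝ} (cω : ContDiff ℝ 2 ω) (sω : HasCompactSupport ω) (hω : ∀ v, 0 ≤ ω v)
    (ch : ContDiff ℝ 2 h) (hh : ∀ v, 0 ≤ h v) :
    ∫ v, ω v * ∑ i, ∑ j, A v i j * pd i (pd j h) v ≤
      ∫ v, (-2 * ∑ i, ∑ j, A v i j * pd i ω v * pd j h v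
        - (∑ i, ∑ j, A v i j * pd i (pd j ω) v) * h v) := by
  have cω1 : ContDiff ℝ 1 ω := cω.of_le (by norm_num)
  have ch1 : ContDiff ℝ 1 h := ch.of_le (by norm_num)
  have cα1 : ContDiff ℝ 1 α := H.cα.of_le (by norm_num)
  have dω : ∀ i, ContDiff ℝ 1 (pd i ω) := fun i => contDiff_pd (n := 1) i cω
  have dh : ∀ i, ContDiff ℝ 1 (pd i h) := fun i => contDiff_pd (n := 1) i ch
  have dα : ∀ i, ContDiff ℝ 1 (pd i α) := fun i => contDiff_pd (n := 1) i H.cα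
  have dA : ∀ i j k, Continuous (pd k (fun v => A v i j)) :=
    fun i j k => (contDiff_pd (n := 0) k (H.cA i j)).continuous
  have ddω : ∀ i j, Continuous (pd i (pd j ω)) :=
    fun i j => (contDiff_pd (n := 0) i (dω j)).continuous
  have ddh : ∀ i j, Continuous (pd i (pd j h)) :=
    fun i j => (contDiff_pd (n := 0) i (dh j)).continuous
  have ddα : ∀ i j, Continuous (pd i (pd j α)) :=
    fun i j => (contDiff_pd (n := 0) i (dα j)).continuous
  have cAc : ∀ i j, Continuous (fun v => A v i j) := fun i j => (H.cA i j).continuous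
  have sdω : ∀ i, HasCompactSupport (pd i ω) := fun i => pd_hcs i sω
  have sddω : ∀ i j, HasCompactSupport (pd i (pd j ω)) := fun i j => pd_hcs i (sdω j)
  have dfω : Differentiable ℝ ω := cω1.differentiable one_ne_zero
  have dfh : Differentiable ℝ h := ch1.differentiable one_ne_zero
  have dfA : ∀ i j, Differentiable ℝ (fun v => A v i j) :=
    fun i j => (H.cA i j).differentiable one_ne_zero
  have dfdω : ∀ i, Differentiable ℝ (pd i ω) := fun i => (dω i).differentiable one_ne_zero
  have dfdα : ∀ i, Differentiable ℝ (pd i α) := fun i => (dα i).differentiable one_ne_zero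
  have dfdh : ∀ i, Differentiable ℝ (pd i h) := fun i => (dh i).differentiable one_ne_zero
  have I1 : ∀ i j, Integrable (fun v => ω v * A v i j * pd i (pd j h) v) := fun i j =>
    ((cω.continuous.mul (cAc i j)).mul (ddh i j)).integrable_of_hasCompactSupport
      (sω.mul_right.mul_right)
  have I2 : ∀ i j, Integrable (fun v => A v i j * pd i ω v * pd j h v) := fun i j =>
    (((cAc i j).mul (dω i).continuous).mul (dh j).continuous).integrable_of_hasCompactSupport
      ((sdω i).mul_left.mul_right)
  have I3 : ∀ i j, Integrable (fun v => A v i j * pd i (pd j ω) v * h v) := fun i j =>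
    (((cAc i j).mul (ddω i j)).mul ch.continuous).integrable_of_hasCompactSupport
      ((sddω i j).mul_left.mul_right)
  have I4 : ∀ i j, Integrable (fun v => ω v * pd i (fun u => A u i j) v * pd j h v) := fun i j =>
    ((cω.continuous.mul (dA i j i)).mul (dh j).continuous).integrable_of_hasCompactSupport
      (sω.mul_right.mul_right)
  have I5 : ∀ j, Integrable (fun v => ω v * pd j α v * pd j h v) := fun j =>
    ((cω.continuous.mul (dα j).continuous).mul (dh j).continuous).integrable_of_hasCompactSupport
      (sω.mul_right.mul_right)
  have I6 : ∀ j, Integrable (fun v => ω v * pd j (pd j α) v * h v) := fun j =>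
    ((cω.continuous.mul (ddα j j)).mul ch.continuous).integrable_of_hasCompactSupport
      (sω.mul_right.mul_right)
  have I7 : ∀ j, Integrable (fun v => pd j ω v * pd j α v * h v) := fun j =>
    (((dω j).continuous.mul (dα j).continuous).mul ch.continuous).integrable_of_hasCompactSupport
      ((sdω j).mul_right.mul_right)
  have I8 : ∀ i j, Integrable (fun v => pd j ω v * pd i (fun u => A u i j) v * h v) := fun i j =>
    (((dω j).continuous.mul (dA i j i)).mul ch.continuous).integrable_of_hasCompactSupport
      ((sdω j).mul_right.mul_right)
  have I2' : ∀ i j, Integrable (fun v => A v i j * pd j ω v * pd i h v) := fun i j =>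
    (((cAc i j).mul (dω j).continuous).mul (dh i).continuous).integrable_of_hasCompactSupport
      ((sdω j).mul_left.mul_right)
  have S1 : ∀ i j, ∫ v, ω v * A v i j * pd i (pd j h) v =
      - (∫ v, A v i j * pd i ω v * pd j h v)
        - ∫ v, ω v * pd i (fun u => A u i j) v * pd j h v := by
    intro i j
    rw [ibp i (cω1.mul (H.cA i j)) (dh j) sω.mul_right, ← neg_add', ← integral_add (I2 i j) (I4 i j)]
    congr 1; refine integral_congr_ae (Filter.Eventually.of_forall fun v => ?_)
    simp only
    rw [pd_mul i (dfω v) (dfA i j v)]; ring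
  have S2 : ∀ j, ∫ v, ω v * pd j α v * pd j h v =
      - (∫ v, pd j ω v * pd j α v * h v) - ∫ v, ω v * pd j (pd j α) v * h v := by
    intro j
    rw [ibp j (cω1.mul (dα j)) ch1 sω.mul_right, ← neg_add', ← integral_add (I7 j) (I6 j)]
    congr 1; refine integral_congr_ae (Filter.Eventually.of_forall fun v => ?_)
    simp only
    rw [pd_mul j (dfω v) (dfdα j v)]; ring
  have S3 : ∀ i j, ∫ v, pd j ω v * pd i (fun u => A u i j) v * h v =
      - (∫ v, A v i j * pd i (pd j ω) v * h v) - ∫ v, A v i j * pd j ω v * pd i h v := by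
    intro i j
    rw [← neg_add', ← integral_add (I3 i j) (I2' i j)]
    have := ibp i ((dω j).mul ch1) (H.cA i j) (sdω j).mul_right
    calc _ = ∫ v, (pd j ω v * h v) * pd i (fun u => A u i j) v := by congr 1; ext v; ring
      _ = _ := this
      _ = _ := by
        congr 1; refine integral_congr_ae (Filter.Eventually.of_forall fun v => ?_)
        simp only
        rw [pd_mul i (dfdω j v) (dfh v)]; ring
  have T1 : ∫ v, ω v * ∑ i, ∑ j, A v i j * pd i (pd j h) v =
      ∑ i, ∑ j, ∫ v, ω v * A v i j * pd i (pd j h) v := by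
    rw [← isum2 I1]
    congr 1; ext v; simp only [Finset.mul_sum, mul_assoc]
  have T2 : ∀ j, ∑ i, ∫ v, ω v * pd i (fun u => A u i j) v * pd j h v =
      ∫ v, ω v * pd j α v * pd j h v := by
    intro j
    rw [← integral_finsetSum _ (fun i _ => I4 i j)]
    congr 1; ext v; rw [← H.div j v, Finset.mul_sum, Finset.sum_mul]
  have T3 : ∀ j, ∑ i, ∫ v, pd j ω v * pd i (fun u => A u i j) v * h v =
      ∫ v, pd j ω v * pd j α v * h v := by
    intro j
    rw [← integral_finsetSum _ (fun i _ => I8 i j)]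
    congr 1; ext v; rw [← H.div j v, Finset.mul_sum, Finset.sum_mul]
  have T4 : ∑ j, ∫ v, ω v * pd j (pd j α) v * h v ≤ 0 := by
    rw [← integral_finsetSum _ (fun j _ => I6 j)]
    refine integral_nonpos fun v => ?_
    simp only [Pi.zero_apply]
    rw [← Finset.sum_mul, ← Finset.mul_sum]
    exact mul_nonpos_of_nonpos_of_nonneg
      (mul_nonpos_of_nonneg_of_nonpos (hω v) (H.lap v)) (hh v)
  have T5 : ∑ j, ∑ i, ∫ v, A v i j * pd j ω v * pd i h v =
      ∑ i, ∑ j, ∫ v, A v i j * pd i ω v * pd j h v := by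
    refine Finset.sum_congr rfl fun j _ => Finset.sum_congr rfl fun i _ => ?_
    congr 1; ext v; rw [H.sym v i j]
  have T6 : ∫ v, (-2 * ∑ i, ∑ j, A v i j * pd i ω v * pd j h v
        - (∑ i, ∑ j, A v i j * pd i (pd j ω) v) * h v) =
      -2 * ∑ i, ∑ j, (∫ v, A v i j * pd i ω v * pd j h v)
        - ∑ i, ∑ j, ∫ v, A v i j * pd i (pd j ω) v * h v := by
    rw [← isum2 I2, ← isum2 I3, ← integral_const_mul, ← integral_sub]
    · congr 1; ext v; simp only [Finset.sum_mul]
    · exact (integrable_finsetSum _ fun i _ => integrable_finsetSum _ fun j _ => I2 i j).const_mul _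
    · exact integrable_finsetSum _ fun i _ => integrable_finsetSum _ fun j _ => I3 i j
  rw [T1, T6]
  simp only [S1, Finset.sum_sub_distrib, Finset.sum_neg_distrib]
  have e1 : ∑ i, ∑ j, ∫ v, ω v * pd i (fun u => A u i j) v * pd j h v =
      - (∑ j, ∑ i, ∫ v, pd j ω v * pd i (fun u => A u i j) v * h v)
      - ∑ j, ∫ v, ω v * pd j (pd j α) v * h v := by
    rw [Finset.sum_comm]
    simp only [T2, T3, S2, Finset.sum_sub_distrib, Finset.sum_neg_distrib]
  have e2 : ∑ j, ∑ i, ∫ v, pd j ω v * pd i (fun u => A u i j) v * h v =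
      - (∑ i, ∑ j, ∫ v, A v i j * pd i (pd j ω) v * h v)
      - ∑ i, ∑ j, ∫ v, A v i j * pd i ω v * pd j h v := by
    simp only [S3, Finset.sum_sub_distrib, Finset.sum_neg_distrib]
    rw [T5, Finset.sum_comm]
  rw [e1, e2]
  linarith

end MPB

namespace MPB

/-- dominating kernel -/
def mm (w : V3) : ℝ := ((1 + ‖w‖) ^ 4)⁻¹ * ‖w‖⁻¹

lemma mm_nonneg (w : V3) : 0 ≤ mm w := by unfold mm; positivity

lemma integrable_mm : Integrable mm := by
  have := (integrable_fun_norm_addHaar (volume : Measure V3)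
    (f := fun y : ℝ => ((1 + y) ^ 4)⁻¹ * y⁻¹)).2 ?_
  · exact this
  · have hb : IntegrableOn (fun y : ℝ => (1 + y ^ 2)⁻¹) (Set.Ioi 0) :=
      integrable_inv_one_add_sq.integrableOn
    refine Integrable.mono' hb ?_ ?_
    · fun_prop
    · refine (ae_restrict_iff' measurableSet_Ioi).2 (Filter.Eventually.of_forall fun y hy => ?_)
      have hy : 0 < y := hy
      simp only [finrank_euclideanSpace, Fintype.card_fin, smul_eq_mul]
      rw [Real.norm_of_nonneg (by positivity)]
      have e : y ^ (3 - 1) * (((1 + y) ^ 4)⁻¹ * y⁻¹) = y / (1 + y) ^ 4 := by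
        field_simp
      rw [e, ← one_div, div_le_div_iff₀ (by positivity) (by positivity)]
      nlinarith [pow_pos hy 2, pow_pos hy 3, pow_pos hy 4]

variable {E : Type} [NormedAddCommGroup E] [NormedSpace ℝ E]

lemma schw_bound (φ : SchwartzMap V3 E) : ∃ C, 0 ≤ C ∧ ∀ v w : V3,
    ‖φ (v - w)‖ ≤ C * (1 + ‖v‖) ^ 4 * ((1 + ‖w‖) ^ 4)⁻¹ := by
  have h := SchwartzMap.one_add_le_sup_seminorm_apply (𝕜 := ℝ) (m := (4, 0)) (k := 4) (n := 0)
    le_rfl le_rfl φ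
  set C := 2 ^ (4, 0).1 * (Finset.Iic (4, 0)).sup (fun m => SchwartzMap.seminorm ℝ m.1 m.2) φ
  have hC : 0 ≤ C := le_trans (by positivity) (h 0)
  refine ⟨C, hC, fun v w => ?_⟩
  have h1 := h (v - w)
  rw [norm_iteratedFDeriv_zero] at h1
  rw [← div_eq_mul_inv, le_div_iff₀ (by positivity)]
  have h2 : 1 + ‖w‖ ≤ (1 + ‖v‖) * (1 + ‖v - w‖) := by
    have : ‖w‖ ≤ ‖v‖ + ‖v - w‖ := by
      calc ‖w‖ = ‖v - (v - w)‖ := by congr 1; abel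
        _ ≤ _ := norm_sub_le _ _
    nlinarith [norm_nonneg v, norm_nonneg (v - w), mul_nonneg (norm_nonneg v) (norm_nonneg (v - w))]
  calc ‖φ (v - w)‖ * (1 + ‖w‖) ^ 4 ≤ ‖φ (v - w)‖ * ((1 + ‖v‖) * (1 + ‖v - w‖)) ^ 4 := by gcongr
    _ = ((1 + ‖v - w‖) ^ 4 * ‖φ (v - w)‖) * (1 + ‖v‖) ^ 4 := by ring
    _ ≤ _ := by gcongr

/-- kernels bounded by a multiple of `1/|w|` -/
structure Ker (κ : V3 → ℝ) : Prop where
  meas : Measurable κ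
  bd : ∃ C, 0 ≤ C ∧ ∀ w, |κ w| ≤ C * ‖w‖⁻¹

/-- convolution of a kernel with a Schwartz function -/
def Pc (κ : V3 → ℝ) (φ : V3 → E) (v : V3) : E := ∫ w, κ w • φ (v - w)

lemma pc_dom {κ : V3 → ℝ} (hκ : Ker κ) (φ : SchwartzMap V3 E) : ∃ C, 0 ≤ C ∧ ∀ v w : V3,
    ‖κ w • φ (v - w)‖ ≤ C * (1 + ‖v‖) ^ 4 * mm w := by
  obtain ⟨C, hC, h⟩ := schw_bound φ
  obtain ⟨D, hD, hd⟩ := hκ.bd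
  refine ⟨D * C, by positivity, fun v w => ?_⟩
  rw [norm_smul, Real.norm_eq_abs]
  calc _ ≤ (D * ‖w‖⁻¹) * (C * (1 + ‖v‖) ^ 4 * ((1 + ‖w‖) ^ 4)⁻¹) := by
        gcongr
        · exact hd w
        · exact h v w
    _ = _ := by unfold mm; ring

lemma pc_meas {κ : V3 → ℝ} (hκ : Ker κ) (φ : SchwartzMap V3 E) (v : V3) :
    AEStronglyMeasurable (fun w => κ w • φ (v - w)) :=
  hκ.meas.aestronglyMeasurable.smul (φ.continuous.comp (by fun_prop)).aestronglyMeasurable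

lemma pc_int {κ : V3 → ℝ} (hκ : Ker κ) (φ : SchwartzMap V3 E) (v : V3) :
    Integrable (fun w => κ w • φ (v - w)) := by
  obtain ⟨C, hC, h⟩ := pc_dom hκ φ
  exact (integrable_mm.const_mul (C * (1 + ‖v‖) ^ 4)).mono' (pc_meas hκ φ v)
    (Filter.Eventually.of_forall fun w => h v w)

lemma pc_hasFDerivAt {κ : V3 → ℝ} (hκ : Ker κ) (φ : SchwartzMap V3 E) (v : V3) :
    HasFDerivAt (Pc κ φ) (Pc κ (SchwartzMap.fderivCLM ℝ V3 E φ) v) v := by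
  obtain ⟨C, hC, h⟩ := pc_dom hκ (SchwartzMap.fderivCLM ℝ V3 E φ)
  refine hasFDerivAt_integral_of_dominated_of_fderiv_le (Metric.ball_mem_nhds v one_pos)
    (F := fun x w => κ w • φ (x - w))
    (F' := fun x w => κ w • SchwartzMap.fderivCLM ℝ V3 E φ (x - w))
    (bound := fun w => C * (1 + (‖v‖ + 1)) ^ 4 * mm w) ?_ ?_ ?_ ?_ ?_ ?_
  · exact Filter.Eventually.of_forall fun x => pc_meas hκ φ x
  · exact pc_int hκ φ v
  · exact pc_meas hκ _ v
  · refine Filter.Eventually.of_forall fun w x hx => (h x w).trans ?_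
    have : ‖x‖ ≤ ‖v‖ + 1 := by
      rw [Metric.mem_ball, dist_eq_norm] at hx
      calc ‖x‖ = ‖v + (x - v)‖ := by congr 1; abel
        _ ≤ ‖v‖ + ‖x - v‖ := norm_add_le _ _
        _ ≤ _ := by linarith
    have := mm_nonneg w
    gcongr
  · exact integrable_mm.const_mul _
  · refine Filter.Eventually.of_forall fun w x _ => ?_
    have h1 : HasFDerivAt (φ : V3 → E) (fderiv ℝ φ (x - w)) (x - w) :=
      (φ.differentiableAt).hasFDerivAt
    have h2 : HasFDerivAt (fun x : V3 => x - w) (ContinuousLinearMap.id ℝ V3) x :=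
      (hasFDerivAt_id x).sub_const w
    have := (h1.comp x h2).const_smul (κ w)
    rw [ContinuousLinearMap.comp_id] at this
    exact this

lemma pc_contDiff {κ : V3 → ℝ} (hκ : Ker κ) (n : ℕ) : ∀ {E : Type} [NormedAddCommGroup E]
    [NormedSpace ℝ E] (φ : SchwartzMap V3 E), ContDiff ℝ n (Pc κ φ) := by
  induction n with
  | zero =>
    intro E _ _ φ
    have : Differentiable ℝ (Pc κ φ) := fun v => (pc_hasFDerivAt hκ φ v).differentiableAt
    exact contDiff_zero.2 this.continuous
  | succ n ih =>
    intro E _ _ φ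
    have : fderiv ℝ (Pc κ φ) = Pc κ (SchwartzMap.fderivCLM ℝ V3 E φ) := by
      ext1 v; exact (pc_hasFDerivAt hκ φ v).fderiv
    push_cast
    refine contDiff_succ_iff_fderiv.2 ⟨fun v => (pc_hasFDerivAt hκ φ v).differentiableAt, ?_, ?_⟩
    · simp
    · rw [this]; exact ih _

/-- partial derivative of a Schwartz function -/
def pds (i : Fin 3) (φ : SchwartzMap V3 ℝ) : SchwartzMap V3 ℝ :=
  SchwartzMap.evalCLM ℝ V3 ℝ (EuclideanSpace.single i 1) (SchwartzMap.fderivCLM ℝ V3 ℝ φ)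

lemma pds_apply (i : Fin 3) (φ : SchwartzMap V3 ℝ) (v : V3) : pds i φ v = pd i φ v := rfl

lemma pd_pc {κ : V3 → ℝ} (hκ : Ker κ) (φ : SchwartzMap V3 ℝ) (i : Fin 3) (v : V3) :
    pd i (Pc κ φ) v = Pc κ (pds i φ) v := by
  unfold pd
  rw [(pc_hasFDerivAt hκ φ v).fderiv]
  unfold Pc
  rw [ContinuousLinearMap.integral_apply (pc_int hκ _ v)]
  rfl

lemma pc_bdd {κ : V3 → ℝ} (hκ : Ker κ) (φ : SchwartzMap V3 ℝ) : ∃ C, ∀ v, |Pc κ φ v| ≤ C := by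
  obtain ⟨C, hC, h⟩ := schw_bound φ
  obtain ⟨D, hD, hd⟩ := hκ.bd
  have hφ : Integrable (fun w => ‖φ w‖) := φ.integrable.norm
  have hb : ∀ w, ‖φ w‖ ≤ C := fun w => by
    have h1 := h 0 (-w)
    rw [zero_sub, neg_neg, norm_zero, norm_neg] at h1
    refine h1.trans ?_
    have : ((1 + ‖w‖) ^ 4)⁻¹ ≤ 1 := inv_le_one_of_one_le₀ (one_le_pow₀ (by linarith [norm_nonneg w]))
    calc _ ≤ C * (1 + 0) ^ 4 * 1 := by gcongr
      _ = C := by ring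
  refine ⟨16 * D * C * (∫ w, mm w) + D * ∫ w, ‖φ w‖, fun v => ?_⟩
  have hφ' : Integrable (fun w => ‖φ (v - w)‖) := hφ.comp_sub_left v
  have e : ∫ w, ‖φ w‖ = ∫ w, ‖φ (v - w)‖ := (integral_sub_left_eq_self (fun w => ‖φ w‖) volume v).symm
  rw [e, ← integral_const_mul, ← integral_const_mul, ← integral_add (integrable_mm.const_mul _)
    (hφ'.const_mul _)]
  rw [← Real.norm_eq_abs]
  unfold Pc
  refine norm_integral_le_of_norm_le ((integrable_mm.const_mul _).add (hφ'.const_mul _))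
    (Filter.Eventually.of_forall fun w => ?_)
  rw [norm_smul]
  have h0 := mm_nonneg w
  by_cases hw : ‖w‖ ≤ 1
  · have : ‖κ w‖ ≤ D * (16 * mm w) := by
      refine (hd w).trans ?_
      gcongr
      unfold mm
      rw [← mul_assoc]
      refine le_mul_of_one_le_left (by positivity) ?_
      rw [← div_eq_mul_inv, one_le_div (by positivity)]
      calc (1 + ‖w‖) ^ 4 ≤ (1 + 1) ^ 4 := by gcongr
        _ = 16 := by norm_num
    calc _ ≤ D * (16 * mm w) * C := by gcongr; exact hb _
      _ ≤ _ := by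
        have : 0 ≤ D * ‖φ (v - w)‖ := by positivity
        linarith
  · have : ‖κ w‖ ≤ D := by
      refine (hd w).trans ?_
      refine mul_le_of_le_one_right hD (inv_le_one_of_one_le₀ (by linarith))
    calc _ ≤ D * ‖φ (v - w)‖ := by gcongr
      _ ≤ _ := by
        have : 0 ≤ 16 * D * C * mm w := by positivity
        linarith

end MPB

namespace MPB

/-- bounded functions -/
def BF (F : V3 → ℝ) : Prop := ∃ C, ∀ w, |F w| ≤ C

lemma BF.mul {F G : V3 → ℝ} (hF : BF F) (hG : BF G) : BF (fun w => F w * G w) := by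
  obtain ⟨C, hC⟩ := hF
  obtain ⟨D, hD⟩ := hG
  refine ⟨C * D, fun w => ?_⟩
  rw [abs_mul]
  have := (abs_nonneg _).trans (hC w)
  gcongr
  · exact hC w
  · exact hD w

lemma BF.add {F G : V3 → ℝ} (hF : BF F) (hG : BF G) : BF (fun w => F w + G w) := by
  obtain ⟨C, hC⟩ := hF
  obtain ⟨D, hD⟩ := hG
  exact ⟨C + D, fun w => (abs_add_le _ _).trans (add_le_add (hC w) (hD w))⟩

lemma BF.sub {F G : V3 → ℝ} (hF : BF F) (hG : BF G) : BF (fun w => F w - G w) := by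
  obtain ⟨C, hC⟩ := hF
  obtain ⟨D, hD⟩ := hG
  exact ⟨C + D, fun w => (abs_sub _ _).trans (add_le_add (hC w) (hD w))⟩

lemma BF.const (c : ℝ) : BF (fun _ => c) := ⟨|c|, fun _ => le_rfl⟩

lemma BF.int {κ : V3 → ℝ} (c : Continuous κ) (b : BF κ) (φ : SchwartzMap V3 ℝ) (v : V3) :
    Integrable (fun w => κ w * φ (v - w)) := by
  obtain ⟨C, hC⟩ := b
  exact (φ.integrable.comp_sub_left v).bdd_mul c.aestronglyMeasurable (c := C)
    (Filter.Eventually.of_forall hC)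

lemma pc_ibp {κ : V3 → ℝ} (c : ContDiff ℝ 1 κ) (b : BF κ) (i : Fin 3) (b' : BF (pd i κ))
    (φ : SchwartzMap V3 ℝ) (v : V3) : Pc κ (pds i φ) v = Pc (pd i κ) φ v := by
  have c' : Continuous (pd i κ) := (contDiff_pd (n := 0) i c).continuous
  have e : ∀ w, fderiv ℝ (fun w => φ (v - w)) w (EuclideanSpace.single i 1) = - pds i φ (v - w) := by
    intro w
    have h1 : HasFDerivAt (φ : V3 → ℝ) (fderiv ℝ φ (v - w)) (v - w) :=
      (φ.differentiableAt).hasFDerivAt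
    have h2 : HasFDerivAt (fun w : V3 => v - w) (-ContinuousLinearMap.id ℝ V3) w :=
      (hasFDerivAt_id w).const_sub v
    have := (h1.comp w h2).fderiv
    rw [show (fun w => φ (v - w)) = φ ∘ (fun w : V3 => v - w) from rfl, this, pds_apply]
    simp [pd]
  have := integral_mul_fderiv_eq_neg_fderiv_mul_of_integrable (μ := (volume : Measure V3))
    (f := κ) (g := fun w => φ (v - w)) (v := EuclideanSpace.single i 1) ?_ ?_ ?_ ?_ ?_
  · simp only [e, mul_neg, integral_neg, neg_inj] at this
    exact this
  · exact BF.int c' b' φ v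
  · simp only [e, mul_neg]
    exact (BF.int c.continuous b (pds i φ) v).neg
  · exact BF.int c.continuous b φ v
  · exact fun x _ => c.differentiable one_ne_zero x
  · intro x _
    have h2 : DifferentiableAt ℝ (fun w : V3 => v - w) x := by fun_prop
    exact (φ.differentiableAt (x := v - x)).comp x h2

lemma pc_lim {κ : V3 → ℝ} {κs : ℕ → V3 → ℝ} (hm : ∀ n, Continuous (κs n))
    {C : ℝ} (hC : 0 ≤ C) (hb : ∀ n w, w ≠ 0 → |κs n w| ≤ C * ‖w‖⁻¹)
    (hl : ∀ w, w ≠ 0 → Filter.Tendsto (fun n => κs n w) Filter.atTop (nhds (κ w)))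
    (φ : SchwartzMap V3 ℝ) (v : V3) :
    Filter.Tendsto (fun n => Pc (κs n) φ v) Filter.atTop (nhds (Pc κ φ v)) := by
  obtain ⟨D, hD, h⟩ := schw_bound φ
  have h0 : ∀ᵐ w : V3, w ≠ 0 := by
    rw [ae_iff]; simp
  refine tendsto_integral_of_dominated_convergence
    (fun w => C * (D * (1 + ‖v‖) ^ 4) * mm w) ?_ ?_ ?_ ?_
  · intro n
    exact ((hm n).smul (φ.continuous.comp (by fun_prop))).aestronglyMeasurable
  · exact integrable_mm.const_mul _
  · intro n
    filter_upwards [h0] with w hw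
    rw [norm_smul, Real.norm_eq_abs]
    calc _ ≤ (C * ‖w‖⁻¹) * (D * (1 + ‖v‖) ^ 4 * ((1 + ‖w‖) ^ 4)⁻¹) := by
          gcongr
          · exact hb n w hw
          · exact h v w
      _ = _ := by unfold mm; ring
  · filter_upwards [h0] with w hw
    exact (hl w hw).smul_const _

/-- regularised inverse norm -/
def sg (e : ℝ) (w : V3) : ℝ := (√(‖w‖ ^ 2 + e))⁻¹

lemma sg_pos {e : ℝ} (he : 0 < e) (w : V3) : 0 < sg e w := by unfold sg; positivity

lemma sg_sq {e : ℝ} (he : 0 < e) (w : V3) : sg e w ^ 2 * (‖w‖ ^ 2 + e) = 1 := by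
  unfold sg
  rw [inv_pow, Real.sq_sqrt (by positivity)]
  field_simp

lemma sg_contDiff {e : ℝ} (he : 0 < e) {n : WithTop ℕ∞} : ContDiff ℝ n (sg e) := by
  unfold sg
  have h1 : ContDiff ℝ n (fun w : V3 => ‖w‖ ^ 2 + e) := (contDiff_norm_sq ℝ).add contDiff_const
  have h2 : ContDiff ℝ n (fun w : V3 => √(‖w‖ ^ 2 + e)) := h1.sqrt (fun w => by positivity)
  exact h2.inv (fun w => by positivity)

lemma norm_sq_coord (w : V3) : ‖w‖ ^ 2 = ∑ i, w i ^ 2 := by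
  rw [EuclideanSpace.norm_sq_eq]; simp

lemma abs_coord_le (w : V3) (i : Fin 3) : |w i| ≤ ‖w‖ := by
  simpa using PiLp.norm_apply_le w i

lemma pd_norm_sq (i : Fin 3) (v : V3) : pd i (fun w : V3 => ‖w‖ ^ 2) v = 2 * v i := by
  have : (fun w : V3 => ‖w‖ ^ 2) = fun w => ∑ j, w j * w j := by
    ext w; rw [norm_sq_coord]; simp [sq]
  have hd : ∀ j, DifferentiableAt ℝ (fun u : V3 => u j) v :=
    fun j => (contDiff_coord (n := 1) j).differentiable one_ne_zero v
  rw [this, pd_sum _ i fun j _ => (hd j).fun_mul (hd j)]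
  simp only [pd_mul i (hd _) (hd _), pd_coord]
  simp [Finset.sum_add_distrib]; ring

lemma pd_sg {e : ℝ} (he : 0 < e) (i : Fin 3) (v : V3) : pd i (sg e) v = - (v i * sg e v ^ 3) := by
  have hp : 0 < ‖v‖ ^ 2 + e := by positivity
  have h1 : HasDerivAt (fun x : ℝ => (√(x + e))⁻¹)
      (-(1 / (2 * √(‖v‖ ^ 2 + e))) / (√(‖v‖ ^ 2 + e)) ^ 2) (‖v‖ ^ 2) := by
    have := ((hasDerivAt_id (‖v‖ ^ 2)).add_const e).sqrt hp.ne'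
    exact this.inv (by positivity)
  have := pd_comp (F := fun w : V3 => ‖w‖ ^ 2) i h1
    ((contDiff_norm_sq ℝ (n := 1)).differentiable one_ne_zero v)
  rw [pd_norm_sq] at this
  rw [show sg e = fun u => (√(‖u‖ ^ 2 + e))⁻¹ from rfl, this]
  field_simp

lemma sg_le {e : ℝ} (he : 0 < e) (w : V3) (hw : w ≠ 0) : sg e w ≤ ‖w‖⁻¹ := by
  unfold sg
  have : 0 < ‖w‖ := norm_pos_iff.2 hw
  gcongr
  exact Real.le_sqrt_of_sq_le (by linarith)

lemma sg_bf {e : ℝ} (he : 0 < e) : BF (sg e) := ⟨(√e)⁻¹, fun w => by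
  rw [abs_of_pos (sg_pos he w)]; unfold sg
  gcongr
  nlinarith [norm_nonneg w]⟩

lemma coord_sg_le {e : ℝ} (he : 0 < e) (w : V3) (i : Fin 3) : |w i * sg e w| ≤ 1 := by
  rw [abs_mul, abs_of_pos (sg_pos he w)]
  unfold sg
  rw [← div_eq_mul_inv, div_le_one (by positivity)]
  exact (abs_coord_le w i).trans (Real.le_sqrt_of_sq_le (by linarith))

lemma coord_sg_bf {e : ℝ} (he : 0 < e) (i : Fin 3) : BF (fun w => w i * sg e w) :=
  ⟨1, fun w => coord_sg_le he w i⟩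

/-- the Kronecker symbol -/
def dl (i j : Fin 3) : ℝ := if i = j then 1 else 0

/-- regularised matrix kernel -/
def Q (e : ℝ) (i j : Fin 3) (w : V3) : ℝ :=
  (8 * π)⁻¹ * (dl i j * sg e w - w i * w j * sg e w ^ 3)

lemma Q_contDiff {e : ℝ} (he : 0 < e) (i j : Fin 3) {n : WithTop ℕ∞} : ContDiff ℝ n (Q e i j) := by
  unfold Q
  have := sg_contDiff he (n := n)
  exact contDiff_const.mul ((contDiff_const.mul this).sub
    (((contDiff_coord i).mul (contDiff_coord j)).mul (this.pow 3)))

lemma pd_sg3 {e : ℝ} (he : 0 < e) (i : Fin 3) (v : V3) :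
    pd i (fun w => sg e w ^ 3) v = - (3 * v i * sg e v ^ 5) := by
  rw [pd_comp (β := fun x => x ^ 3) i (by simpa using hasDerivAt_pow 3 (sg e v))
    ((sg_contDiff he (n := 1)).differentiable one_ne_zero v), pd_sg he]
  ring

lemma pd_Q {e : ℝ} (he : 0 < e) (l i j : Fin 3) (v : V3) : pd l (Q e i j) v =
    (8 * π)⁻¹ * (- (dl i j * (v l * sg e v ^ 3)) -
      ((dl l i * v j + dl l j * v i) * sg e v ^ 3 - 3 * v i * v j * v l * sg e v ^ 5)) := by
  have ds : DifferentiableAt ℝ (sg e) v := (sg_contDiff he (n := 1)).differentiable one_ne_zero v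
  have ds3 : DifferentiableAt ℝ (fun w => sg e w ^ 3) v := ds.pow 3
  have hd : ∀ j, DifferentiableAt ℝ (fun u : V3 => u j) v :=
    fun j => (contDiff_coord (n := 1) j).differentiable one_ne_zero v
  unfold Q
  rw [pd_const_mul l, pd_sub l, pd_const_mul l _ ds, pd_mul l ((hd i).fun_mul (hd j)) ds3,
    pd_mul l (hd i) (hd j), pd_sg he, pd_sg3 he, pd_coord, pd_coord]
  · unfold dl; ring
  · exact ds.const_mul _
  · exact ((hd i).mul (hd j)).mul ds3
  · exact (ds.const_mul _).sub (((hd i).mul (hd j)).mul ds3)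

lemma Q_bf {e : ℝ} (he : 0 < e) (i j : Fin 3) : BF (Q e i j) := by
  have h := (BF.const ((8 * π)⁻¹)).mul (((BF.const (dl i j)).mul (sg_bf he)).sub
    (((coord_sg_bf he i).mul (coord_sg_bf he j)).mul (sg_bf he)))
  convert h using 2
  unfold Q; ring

lemma pdQ_bf {e : ℝ} (he : 0 < e) (l i j : Fin 3) : BF (pd l (Q e i j)) := by
  have s2 := (sg_bf he).mul (sg_bf he)
  have c := coord_sg_bf he
  have h := (BF.const ((8 * π)⁻¹)).mul
    ((((BF.const (-dl i j)).mul (c l)).mul s2).sub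
      ((((((BF.const (dl l i)).mul (c j)).add ((BF.const (dl l j)).mul (c i)))).mul s2).sub
        (((((BF.const 3).mul (c i)).mul (c j)).mul (c l)).mul s2)))
  convert h using 2
  rw [pd_Q he]; ring

/-- the kernels of the problem -/
def kA (i j : Fin 3) (w : V3) : ℝ :=
  ((if i = j then (1 : ℝ) else 0) - w i * w j / ‖w‖ ^ 2) / (8 * π * ‖w‖)

/-- the Coulomb kernel -/
def k0 (w : V3) : ℝ := 1 / (4 * π * ‖w‖)

lemma kA_eq (i j : Fin 3) (w : V3) :
    kA i j w = (8 * π)⁻¹ * (dl i j * ‖w‖⁻¹ - w i * w j * ‖w‖⁻¹ ^ 3) := by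
  unfold kA dl
  rw [div_eq_mul_inv, mul_inv]
  ring

lemma bd_aux {i j : Fin 3} {w : V3} (hw : w ≠ 0) {s : ℝ} (hs : 0 ≤ s) (h : s ≤ ‖w‖⁻¹) :
    |(8 * π)⁻¹ * (dl i j * s - w i * w j * s ^ 3)| ≤ 1 * ‖w‖⁻¹ := by
  have hw : 0 < ‖w‖ := norm_pos_iff.2 hw
  have h1 : |(8 * π)⁻¹| ≤ 1 / 2 := by
    rw [abs_of_nonneg (by positivity), ← one_div]
    exact one_div_le_one_div_of_le (by norm_num) (by nlinarith [pi_gt_three])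
  have h2 : |dl i j| ≤ 1 := by unfold dl; split_ifs <;> simp
  have h3 : ‖w‖ * s ≤ 1 := by
    calc _ ≤ ‖w‖ * ‖w‖⁻¹ := by gcongr
      _ = 1 := by field_simp
  have h4 : |dl i j * s| ≤ ‖w‖⁻¹ := by
    rw [abs_mul, abs_of_nonneg hs]
    calc _ ≤ 1 * ‖w‖⁻¹ := by gcongr
      _ = _ := one_mul _
  have h5 : |w i * w j * s ^ 3| ≤ ‖w‖⁻¹ := by
    rw [abs_mul, abs_mul, abs_of_nonneg (pow_nonneg hs 3)]
    calc _ ≤ ‖w‖ * ‖w‖ * s ^ 3 := by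
          gcongr
          · exact abs_coord_le w i
          · exact abs_coord_le w j
      _ = (‖w‖ * s) * (‖w‖ * s) * s := by ring
      _ ≤ 1 * 1 * ‖w‖⁻¹ := by gcongr
      _ = _ := by ring
  rw [abs_mul]
  calc _ ≤ 1 / 2 * (‖w‖⁻¹ + ‖w‖⁻¹) := by
        gcongr
        exact (abs_sub _ _).trans (add_le_add h4 h5)
    _ = _ := by ring

lemma ker_kA (i j : Fin 3) : Ker (kA i j) := by
  refine ⟨?_, 1, zero_le_one, fun w => ?_⟩
  · unfold kA
    have h : ∀ i, Measurable (fun w : V3 => w i) := fun i => (contDiff_coord (n := 0) i).continuous.measurable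
    have h2 : Measurable (fun w : V3 => ‖w‖) := measurable_norm
    exact ((((h i).mul (h j)).div (h2.pow_const 2)).const_sub _).div (h2.const_mul _)
  · by_cases hw : w = 0
    · subst hw; simp [kA]
    · rw [kA_eq]
      exact bd_aux hw (by positivity) le_rfl

lemma ker_k0 : Ker k0 := by
  refine ⟨?_, 1, zero_le_one, fun w => ?_⟩
  · unfold k0
    have h2 : Measurable (fun w : V3 => ‖w‖) := measurable_norm
    exact (h2.const_mul _).const_div _
  · unfold k0
    rw [abs_of_nonneg (by positivity), one_div, mul_inv]
    have : (4 * π)⁻¹ ≤ 1 := inv_le_one_of_one_le₀ (by nlinarith [pi_gt_three])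
    gcongr

lemma k0_eq (w : V3) : k0 w = ∑ l, kA l l w := by
  simp only [kA_eq, ← Finset.mul_sum, Finset.sum_sub_distrib, ← Finset.sum_mul]
  have : ∑ i, w i * w i = ‖w‖ ^ 2 := by rw [norm_sq_coord]; simp [sq]
  rw [this]
  by_cases hw : w = 0
  · subst hw; simp [k0]
  · have hw : 0 < ‖w‖ := norm_pos_iff.2 hw
    simp [k0, dl]
    field_simp
    norm_num

lemma Amat_eq (φ : SchwartzMap V3 ℝ) (v : V3) (i j : Fin 3) :
    Amat φ v i j = Pc (kA i j) φ v := by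
  unfold Amat Pc
  rw [← integral_sub_left_eq_self (fun w => kA i j w • φ (v - w)) volume v]
  congr 1; ext w
  simp only [kA, smul_eq_mul, sub_sub_cancel]
  ring

lemma apot_eq (φ : SchwartzMap V3 ℝ) : apot φ = Pc k0 φ := by
  ext v
  unfold apot Pc
  rw [← integral_sub_left_eq_self (fun w => k0 w • φ (v - w)) volume v]
  congr 1; ext w
  simp only [k0, smul_eq_mul, sub_sub_cancel]
  ring

/-- sequence of regularisation parameters -/
def es (n : ℕ) : ℝ := 1 / ((n : ℝ) + 1)

lemma es_pos (n : ℕ) : 0 < es n := by unfold es; positivity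

lemma sg_lim (w : V3) (hw : w ≠ 0) :
    Filter.Tendsto (fun n => sg (es n) w) Filter.atTop (nhds (‖w‖⁻¹)) := by
  have hw : 0 < ‖w‖ := norm_pos_iff.2 hw
  have h : Filter.Tendsto es Filter.atTop (nhds 0) := tendsto_one_div_add_atTop_nhds_zero_nat
  have h2 : Filter.Tendsto (fun n => √(‖w‖ ^ 2 + es n)) Filter.atTop (nhds (√(‖w‖ ^ 2 + 0))) :=
    (Real.continuous_sqrt.tendsto _).comp (tendsto_const_nhds.add h)
  rw [add_zero, Real.sqrt_sq hw.le] at h2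
  exact h2.inv₀ hw.ne'

lemma Q_lim (i j : Fin 3) (φ : SchwartzMap V3 ℝ) (v : V3) :
    Filter.Tendsto (fun n => Pc (Q (es n) i j) φ v) Filter.atTop (nhds (Pc (kA i j) φ v)) := by
  refine pc_lim (fun n => (Q_contDiff (es_pos n) i j (n := 0)).continuous) zero_le_one ?_ ?_ φ v
  · intro n w hw
    exact bd_aux hw (sg_pos (es_pos n) w).le (sg_le (es_pos n) w hw)
  · intro w hw
    rw [kA_eq]
    have h := sg_lim w hw
    exact (((h.const_mul (dl i j)).sub ((h.pow 3).const_mul (w i * w j)))).const_mul _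

lemma div_aux {e : ℝ} (he : 0 < e) (j : Fin 3) (w : V3) :
    ∑ i, pd i (Q e i j) w = ∑ l, pd j (Q e l l) w := by
  simp only [pd_Q he]
  fin_cases j <;> simp [Fin.sum_univ_three, dl] <;> ring

lemma pc_div (j : Fin 3) (φ : SchwartzMap V3 ℝ) (v : V3) :
    ∑ i, Pc (kA i j) (pds i φ) v = ∑ l, Pc (kA l l) (pds j φ) v := by
  have h1 : Filter.Tendsto (fun n => ∑ i, Pc (Q (es n) i j) (pds i φ) v) Filter.atTop
      (nhds (∑ i, Pc (kA i j) (pds i φ) v)) :=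
    tendsto_finsetSum _ fun i _ => Q_lim i j (pds i φ) v
  have h2 : Filter.Tendsto (fun n => ∑ l, Pc (Q (es n) l l) (pds j φ) v) Filter.atTop
      (nhds (∑ l, Pc (kA l l) (pds j φ) v)) :=
    tendsto_finsetSum _ fun l _ => Q_lim l l (pds j φ) v
  refine tendsto_nhds_unique h1 (h2.congr fun n => ?_)
  have he := es_pos n
  have e1 : ∀ l i j, Pc (Q (es n) i j) (pds l φ) v = Pc (pd l (Q (es n) i j)) φ v := fun l i j =>
    pc_ibp (Q_contDiff he i j) (Q_bf he i j) l (pdQ_bf he l i j) φ v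
  have ii : ∀ l i j, Integrable (fun w => pd l (Q (es n) i j) w * φ (v - w)) := fun l i j =>
    BF.int (contDiff_pd (n := 0) l (Q_contDiff he i j)).continuous (pdQ_bf he l i j) φ v
  simp only [e1]
  unfold Pc
  simp only [smul_eq_mul]
  rw [← integral_finsetSum _ fun i _ => ii j i i, ← integral_finsetSum _ fun i _ => ii i i j]
  congr 1; ext w
  rw [← Finset.sum_mul, ← Finset.sum_mul, div_aux he]

lemma pc_k0 (φ : SchwartzMap V3 ℝ) (v : V3) : Pc k0 φ v = ∑ l, Pc (kA l l) φ v := by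
  unfold Pc
  rw [← integral_finsetSum _ fun l _ => pc_int (ker_kA l l) φ v]
  congr 1; ext w
  rw [k0_eq, Finset.sum_smul]

/-- regularised Coulomb kernel -/
def s0 (e : ℝ) (w : V3) : ℝ := (4 * π)⁻¹ * sg e w

lemma s0_contDiff {e : ℝ} (he : 0 < e) {n : WithTop ℕ∞} : ContDiff ℝ n (s0 e) :=
  contDiff_const.mul (sg_contDiff he)

lemma pd_s0 {e : ℝ} (he : 0 < e) (i : Fin 3) :
    pd i (s0 e) = fun w => -(4 * π)⁻¹ * (w i * sg e w ^ 3) := by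
  ext w
  unfold s0
  rw [pd_const_mul i _ ((sg_contDiff he (n := 1)).differentiable one_ne_zero w), pd_sg he]
  ring

lemma pdd_s0 {e : ℝ} (he : 0 < e) (i : Fin 3) (w : V3) :
    pd i (pd i (s0 e)) w = -(4 * π)⁻¹ * (sg e w ^ 3 - 3 * w i * w i * sg e w ^ 5) := by
  have ds : DifferentiableAt ℝ (sg e) w := (sg_contDiff he (n := 1)).differentiable one_ne_zero w
  have ds3 : DifferentiableAt ℝ (fun w => sg e w ^ 3) w := ds.pow 3
  have hd : ∀ j, DifferentiableAt ℝ (fun u : V3 => u j) w :=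
    fun j => (contDiff_coord (n := 1) j).differentiable one_ne_zero w
  rw [pd_s0 he, pd_const_mul i _ ((hd i).fun_mul ds3), pd_mul i (hd i) ds3, pd_coord, pd_sg3 he]
  simp; ring

lemma s0_lim (φ : SchwartzMap V3 ℝ) (v : V3) :
    Filter.Tendsto (fun n => Pc (s0 (es n)) φ v) Filter.atTop (nhds (Pc k0 φ v)) := by
  refine pc_lim (fun n => (s0_contDiff (es_pos n) (n := 0)).continuous) zero_le_one ?_ ?_ φ v
  · intro n w hw
    have := sg_pos (es_pos n) w
    unfold s0
    rw [abs_of_nonneg (by positivity)]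
    have h2 : (4 * π)⁻¹ ≤ 1 := inv_le_one_of_one_le₀ (by nlinarith [pi_gt_three])
    have := sg_le (es_pos n) w hw
    gcongr
  · intro w hw
    have : k0 w = (4 * π)⁻¹ * ‖w‖⁻¹ := by unfold k0; rw [one_div, mul_inv]
    rw [this]
    exact (sg_lim w hw).const_mul _

lemma pc_lap (φ : SchwartzMap V3 ℝ) (hφ : ∀ w, 0 ≤ φ w) (v : V3) :
    ∑ i, Pc k0 (pds i (pds i φ)) v ≤ 0 := by
  have h1 : Filter.Tendsto (fun n => ∑ i, Pc (s0 (es n)) (pds i (pds i φ)) v) Filter.atTop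
      (nhds (∑ i, Pc k0 (pds i (pds i φ)) v)) :=
    tendsto_finsetSum _ fun i _ => s0_lim _ v
  refine le_of_tendsto h1 (Filter.Eventually.of_forall fun n => ?_)
  have he := es_pos n
  have c := coord_sg_bf he
  have s2 := (sg_bf he).mul (sg_bf he)
  have b0 : BF (s0 (es n)) := (BF.const _).mul (sg_bf he)
  have b1 : ∀ i, BF (pd i (s0 (es n))) := fun i => by
    have := (BF.const (-(4 * π)⁻¹)).mul ((c i).mul s2)
    rw [pd_s0 he]; convert this using 2; ring
  have b2 : ∀ i, BF (pd i (pd i (s0 (es n)))) := fun i => by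
    have := (BF.const (-(4 * π)⁻¹)).mul ((s2.mul (sg_bf he)).sub
      ((((BF.const 3).mul (c i)).mul (c i)).mul (s2.mul (sg_bf he))))
    convert this using 2; rw [pdd_s0 he]; ring
  have c1 : ∀ i, ContDiff ℝ 1 (pd i (s0 (es n))) := fun i =>
    contDiff_pd (n := 1) i (s0_contDiff he)
  have e1 : ∀ i, Pc (s0 (es n)) (pds i (pds i φ)) v = Pc (pd i (pd i (s0 (es n)))) φ v := fun i => by
    rw [pc_ibp (s0_contDiff he) b0 i (b1 i), pc_ibp (c1 i) (b1 i) i (b2 i)]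
  have ii : ∀ i, Integrable (fun w => pd i (pd i (s0 (es n))) w * φ (v - w)) := fun i =>
    BF.int (contDiff_pd (n := 0) i (c1 i)).continuous (b2 i) φ v
  simp only [e1]
  unfold Pc
  simp only [smul_eq_mul]
  rw [← integral_finsetSum _ fun i _ => ii i]
  refine integral_nonpos fun w => ?_
  simp only [Pi.zero_apply]
  rw [← Finset.sum_mul]
  refine mul_nonpos_of_nonpos_of_nonneg ?_ (hφ _)
  simp only [pdd_s0 he]
  rw [← Finset.mul_sum, neg_mul, neg_nonpos]
  refine mul_nonneg (by positivity) ?_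
  have h3 := sg_sq he w
  have h4 := sg_pos he w
  have e4 : ∑ i, (sg (es n) w ^ 3 - 3 * w i * w i * sg (es n) w ^ 5) =
      3 * sg (es n) w ^ 5 * es n := by
    have : ∑ i, (sg (es n) w ^ 3 - 3 * w i * w i * sg (es n) w ^ 5) =
        3 * sg (es n) w ^ 3 * (1 - sg (es n) w ^ 2 * ‖w‖ ^ 2) := by
      rw [norm_sq_coord]; simp [Fin.sum_univ_three]; ring
    rw [this, ← h3]; ring
  rw [e4]; positivity

lemma good_of_schwartz (φ : SchwartzMap V3 ℝ) (hφ : ∀ w, 0 ≤ φ w) : Good (Amat φ) (apot φ) where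
  cA i j := by simp only [Amat_eq]; exact pc_contDiff (ker_kA i j) 1 φ
  sym v i j := by
    rw [Amat_eq, Amat_eq]
    congr 1; ext w; unfold kA; simp only [eq_comm, mul_comm]
  psd v ξ := by
    simp only [Amat_eq]
    unfold Pc
    have : ∑ i, ∑ j, (∫ w, kA i j w • φ (v - w)) * ξ i * ξ j =
        ∫ w, ∑ i, ∑ j, (kA i j w • φ (v - w)) * ξ i * ξ j := by
      rw [isum2 fun i j => ((pc_int (ker_kA i j) φ v).mul_const _).mul_const _]
      simp only [integral_mul_const]
    rw [this]
    refine integral_nonneg fun w => ?_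
    simp only [Pi.zero_apply, smul_eq_mul]
    have e : ∑ i, ∑ j, (kA i j w * φ (v - w)) * ξ i * ξ j =
      (8 * π)⁻¹ * φ (v - w) * ‖w‖⁻¹ * (∑ i, ξ i ^ 2 - (‖w‖⁻¹) ^ 2 * (∑ i, w i * ξ i) ^ 2) := by
      simp only [kA_eq]
      simp [Fin.sum_univ_three, dl]; ring
    rw [e]
    refine mul_nonneg (by have := hφ (v - w); positivity) ?_
    by_cases hw : w = 0
    · subst hw; simp; positivity
    · have hw : 0 < ‖w‖ := norm_pos_iff.2 hw
      have cs := Finset.sum_mul_sq_le_sq_mul_sq Finset.univ (fun i => w i) ξ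
      rw [← norm_sq_coord] at cs
      rw [sub_nonneg]
      calc _ ≤ (‖w‖⁻¹) ^ 2 * (‖w‖ ^ 2 * ∑ i, ξ i ^ 2) := by gcongr
        _ = _ := by field_simp
  cα := by rw [apot_eq]; exact pc_contDiff ker_k0 2 φ
  div j v := by
    simp only [Amat_eq]
    rw [apot_eq]
    have : ∀ i, pd i (fun u => Pc (kA i j) φ u) v = Pc (kA i j) (pds i φ) v :=
      fun i => pd_pc (ker_kA i j) φ i v
    simp only [this]
    rw [pd_pc ker_k0, pc_k0, pc_div]
  lap v := by
    rw [apot_eq]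
    have : ∀ i, pd i (Pc k0 φ) = Pc k0 (pds i φ) := fun i => by
      ext v; exact pd_pc ker_k0 φ i v
    simp only [this, pd_pc ker_k0]
    exact pc_lap φ hφ v

end MPB

namespace MPB

lemma jap_ge_one (v : V3) : 1 ≤ jap v := by
  unfold jap; rw [Real.one_le_sqrt]; nlinarith [norm_nonneg v]

lemma jap_pos (v : V3) : 0 < jap v := lt_of_lt_of_le one_pos (jap_ge_one v)

lemma coord_le_jap (v : V3) (i : Fin 3) : |v i| ≤ jap v :=
  (abs_coord_le v i).trans (Real.le_sqrt_of_sq_le (by linarith))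

lemma jap_rpow (m : ℝ) (v : V3) : jap v ^ m = (1 + ‖v‖ ^ 2) ^ (m / 2) := by
  unfold jap
  rw [Real.sqrt_eq_rpow, ← Real.rpow_mul (by positivity)]
  congr 1; ring

lemma jap_contDiff (m : ℝ) {n : WithTop ℕ∞} : ContDiff ℝ n (fun v => jap v ^ m) := by
  simp only [jap_rpow]
  have h1 : ContDiff ℝ n (fun w : V3 => 1 + ‖w‖ ^ 2) := contDiff_const.add (contDiff_norm_sq ℝ)
  exact h1.rpow_const_of_ne (fun w => by positivity)

lemma jap_diff (m : ℝ) (v : V3) : DifferentiableAt ℝ (fun v => jap v ^ m) v :=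
  (jap_contDiff m (n := 1)).differentiable one_ne_zero v

lemma jap_int {n : ℝ} (hn : n < -3) : Integrable (fun v => jap v ^ n) := by
  have := integrable_rpow_neg_one_add_norm_sq (E := V3) (μ := volume) (r := -n) (by
    simp; linarith)
  simp only [jap_rpow]
  simpa using this

lemma pd_jap (m : ℝ) (i : Fin 3) (v : V3) :
    pd i (fun v => jap v ^ m) v = m * (v i * jap v ^ (m - 2)) := by
  have hp : 0 < 1 + ‖v‖ ^ 2 := by positivity
  have h1 : HasDerivAt (fun x : ℝ => (1 + x) ^ (m / 2))
      (1 * (m / 2) * (1 + ‖v‖ ^ 2) ^ (m / 2 - 1)) (‖v‖ ^ 2) :=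
    ((hasDerivAt_id (‖v‖ ^ 2)).const_add 1).rpow_const (Or.inl hp.ne')
  have := pd_comp (F := fun w : V3 => ‖w‖ ^ 2) i h1
    ((contDiff_norm_sq ℝ (n := 1)).differentiable one_ne_zero v)
  rw [pd_norm_sq] at this
  simp only [jap_rpow]
  rw [this, show (m - 2) / 2 = m / 2 - 1 by ring]
  ring

lemma pdd_jap (m : ℝ) (i j : Fin 3) (v : V3) :
    pd i (pd j (fun v => jap v ^ m)) v =
      m * (v j * ((m - 2) * (v i * jap v ^ (m - 2 - 2))) + dl i j * jap v ^ (m - 2)) := by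
  have : pd j (fun v => jap v ^ m) = fun v => m * (v j * jap v ^ (m - 2)) := by
    ext v; exact pd_jap m j v
  have hd : ∀ j, DifferentiableAt ℝ (fun u : V3 => u j) v :=
    fun j => (contDiff_coord (n := 1) j).differentiable one_ne_zero v
  rw [this, pd_const_mul i _ ((hd j).fun_mul (jap_diff _ v)), pd_mul i (hd j) (jap_diff _ v), pd_jap,
    pd_coord]
  rfl

lemma jap_drop2 (m : ℝ) (v : V3) : jap v ^ (m - 2) * (jap v * jap v) = jap v ^ m := by
  rw [← pow_two, ← Real.rpow_natCast, ← Real.rpow_add (jap_pos v)]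
  congr 1; norm_num

lemma jap_mono (m : ℝ) (v : V3) : jap v ^ (m - 2) ≤ jap v ^ m :=
  Real.rpow_le_rpow_of_exponent_le (jap_ge_one v) (by linarith)

lemma pd_jap_le (m : ℝ) (i : Fin 3) (v : V3) :
    |pd i (fun v => jap v ^ m) v| ≤ |m| * jap v ^ m := by
  rw [pd_jap, abs_mul, abs_mul]
  have h := jap_pos v
  have h1 := jap_ge_one v
  have h2 : 0 < jap v ^ (m - 2) := Real.rpow_pos_of_pos h _
  rw [abs_of_pos h2, ← jap_drop2 m v]
  have := coord_le_jap v i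
  have h3 : |v i| * jap v ^ (m - 2) ≤ jap v ^ (m - 2) * (jap v * jap v) := by
    rw [mul_comm]
    refine mul_le_mul_of_nonneg_left ?_ h2.le
    nlinarith
  exact mul_le_mul_of_nonneg_left h3 (abs_nonneg _)

lemma pdd_jap_le (m : ℝ) (i j : Fin 3) (v : V3) :
    |pd i (pd j (fun v => jap v ^ m)) v| ≤ |m| * (|m - 2| + 1) * jap v ^ m := by
  rw [pdd_jap, abs_mul, mul_assoc]
  have h := jap_pos v
  have h2 : 0 < jap v ^ (m - 2) := Real.rpow_pos_of_pos h _
  have h3 : 0 < jap v ^ (m - 2 - 2) := Real.rpow_pos_of_pos h _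
  gcongr
  refine (abs_add_le _ _).trans ?_
  rw [add_mul]
  refine add_le_add ?_ ?_
  · rw [abs_mul, abs_mul, abs_mul, abs_of_pos h3]
    calc _ ≤ jap v * (|m - 2| * (jap v * jap v ^ (m - 2 - 2))) := by
          gcongr
          · exact coord_le_jap v j
          · exact coord_le_jap v i
      _ = |m - 2| * (jap v ^ (m - 2 - 2) * (jap v * jap v)) := by ring
      _ = |m - 2| * jap v ^ (m - 2) := by rw [jap_drop2]
      _ ≤ _ := mul_le_mul_of_nonneg_left (jap_mono m v) (abs_nonneg _)
  · rw [abs_mul, abs_of_pos h2]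
    have : |dl i j| ≤ 1 := by unfold dl; split_ifs <;> simp
    exact mul_le_mul this (jap_mono m v) h2.le zero_le_one

/-- a fixed smooth cutoff -/
def bump : ContDiffBump (0 : V3) := ⟨1, 2, one_pos, one_lt_two⟩

/-- a fixed smooth cutoff, as a function -/
def psi (v : V3) : ℝ := bump v

lemma psi_contDiff {n : ℕ} : ContDiff ℝ n psi := bump.contDiff
lemma psi_hcs : HasCompactSupport psi := bump.hasCompactSupport

lemma bdd_of_hcs {F : V3 → ℝ} (c : Continuous F) (h : HasCompactSupport F) : ∃ C, ∀ v, |F v| ≤ C :=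
  h.exists_bound_of_continuous c

lemma psi_bd : ∃ C, 0 ≤ C ∧ ∀ v i j, |pd i psi v| ≤ C ∧ |pd i (pd j psi) v| ≤ C := by
  have h1 : ∀ i, ∃ C, ∀ v, |pd i psi v| ≤ C := fun i =>
    bdd_of_hcs (contDiff_pd (n := 0) i psi_contDiff).continuous (pd_hcs i psi_hcs)
  have h2 : ∀ i j, ∃ C, ∀ v, |pd i (pd j psi) v| ≤ C := fun i j =>
    bdd_of_hcs (contDiff_pd (n := 0) i (contDiff_pd (n := 1) j psi_contDiff)).continuous
      (pd_hcs i (pd_hcs j psi_hcs))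
  choose C1 hC1 using h1
  choose C2 hC2 using h2
  have p1 : ∀ i, 0 ≤ C1 i := fun i => (abs_nonneg _).trans (hC1 i 0)
  have p2 : ∀ i j, 0 ≤ C2 i j := fun i j => (abs_nonneg _).trans (hC2 i j 0)
  refine ⟨∑ i, C1 i + ∑ i, ∑ j, C2 i j, add_nonneg (Finset.sum_nonneg fun i _ => p1 i)
    (Finset.sum_nonneg fun i _ => Finset.sum_nonneg fun j _ => p2 i j), fun v i j => ⟨?_, ?_⟩⟩
  · have := Finset.single_le_sum (fun i _ => p1 i) (Finset.mem_univ i)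
    have h3 : 0 ≤ ∑ i, ∑ j, C2 i j :=
      Finset.sum_nonneg fun i _ => Finset.sum_nonneg fun j _ => p2 i j
    linarith [hC1 i v]
  · have := Finset.single_le_sum (f := fun i => ∑ j, C2 i j)
      (fun i _ => Finset.sum_nonneg fun j _ => p2 i j) (Finset.mem_univ i)
    have h4 := Finset.single_le_sum (fun j _ => p2 i j) (Finset.mem_univ j)
    have h3 : 0 ≤ ∑ i, C1 i := Finset.sum_nonneg fun i _ => p1 i
    have := hC2 i j v
    linarith

/-- scaled cutoff -/
def chi (R : ℝ) (v : V3) : ℝ := psi (R⁻¹ • v)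

lemma scal_pd {F : V3 → ℝ} (hF : Differentiable ℝ F) (r : ℝ) (i : Fin 3) (v : V3) :
    pd i (fun v => F (r • v)) v = r * pd i F (r • v) := by
  unfold pd
  have h2 : HasFDerivAt (fun w : V3 => r • w) (r • ContinuousLinearMap.id ℝ V3) v :=
    (hasFDerivAt_id v).const_smul r
  have := ((hF (r • v)).hasFDerivAt.comp v h2).fderiv
  rw [show (fun v => F (r • v)) = F ∘ (fun v => r • v) from rfl, this]
  simp

lemma chi_contDiff (R : ℝ) {n : ℕ} : ContDiff ℝ n (chi R) :=
  psi_contDiff.comp (contDiff_const_smul _)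

lemma chi_hcs {R : ℝ} (hR : 1 ≤ R) : HasCompactSupport (chi R) :=
  psi_hcs.comp_smul (inv_ne_zero (by linarith))

lemma chi_mem (R : ℝ) (v : V3) : 0 ≤ chi R v ∧ chi R v ≤ 1 := ⟨bump.nonneg, bump.le_one⟩

lemma chi_one {R : ℝ} (hR : 1 ≤ R) (v : V3) (hv : ‖v‖ ≤ R) : chi R v = 1 := by
  refine bump.one_of_mem_closedBall ?_
  rw [mem_closedBall_zero_iff, norm_smul, norm_inv, Real.norm_of_nonneg (by linarith)]
  show R⁻¹ * ‖v‖ ≤ 1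
  rw [inv_mul_le_one₀ (by linarith)]; exact hv

lemma chi_bd : ∃ C, 0 ≤ C ∧ ∀ R, 1 ≤ R → ∀ v i j, |pd i (chi R) v| ≤ C * R⁻¹ ∧
    |pd i (pd j (chi R)) v| ≤ C * R⁻¹ := by
  obtain ⟨C, hC, h⟩ := psi_bd
  refine ⟨C, hC, fun R hR v i j => ?_⟩
  have hR0 : 0 ≤ R⁻¹ := by positivity
  have hR1 : R⁻¹ ≤ 1 := inv_le_one_of_one_le₀ hR
  have d1 : Differentiable ℝ psi := (psi_contDiff (n := 1)).differentiable (by norm_num)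
  have d2 : ∀ j, Differentiable ℝ (pd j psi) := fun j =>
    (contDiff_pd (n := 1) j psi_contDiff).differentiable (by norm_num)
  have e1 : ∀ j, pd j (chi R) = fun v => R⁻¹ * pd j psi (R⁻¹ • v) := fun j => by
    ext v; exact scal_pd d1 _ j v
  constructor
  · rw [e1, abs_mul, abs_of_nonneg hR0, mul_comm]
    gcongr
    exact (h _ i j).1
  · have hd : DifferentiableAt ℝ (fun v => pd j psi (R⁻¹ • v)) v :=
      (d2 j (R⁻¹ • v)).comp v (by fun_prop)
    rw [e1, pd_const_mul i _ hd, scal_pd (d2 j), abs_mul, abs_mul, abs_of_nonneg hR0]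
    have := (h (R⁻¹ • v) i j).2
    calc _ ≤ R⁻¹ * (1 * C) := by gcongr
      _ = _ := by ring

/-- square root of the weight -/
def zt (n R : ℝ) (v : V3) : ℝ := jap v ^ (n / 2) * chi R v

lemma zt_contDiff (n R : ℝ) {m : ℕ} : ContDiff ℝ m (zt n R) := (jap_contDiff _).mul (chi_contDiff R)

lemma zt_hcs (n : ℝ) {R : ℝ} (hR : 1 ≤ R) : HasCompactSupport (zt n R) := (chi_hcs hR).mul_left

lemma zt_nonneg (n R : ℝ) (v : V3) : 0 ≤ zt n R v :=
  mul_nonneg (Real.rpow_nonneg (jap_pos v).le _) (chi_mem R v).1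

lemma jap_half (n : ℝ) (v : V3) : jap v ^ (n / 2) * jap v ^ (n / 2) = jap v ^ n := by
  rw [← Real.rpow_add (jap_pos v)]; congr 1; ring

lemma zt_sq_le (n R : ℝ) (v : V3) : zt n R v * zt n R v ≤ jap v ^ n := by
  rw [← jap_half]
  have : zt n R v ≤ jap v ^ (n / 2) :=
    mul_le_of_le_one_right (Real.rpow_nonneg (jap_pos v).le _) (chi_mem R v).2
  have h0 := zt_nonneg n R v
  exact mul_le_mul this this h0 (h0.trans this)

/-- the quantity bounding the derivatives of `zt` -/
def zz (n R : ℝ) (v : V3) : ℝ := zt n R v + jap v ^ (n / 2) * R⁻¹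

lemma zz_sq {n R : ℝ} (v : V3) : zz n R v ^ 2 ≤
    2 * (zt n R v * zt n R v + jap v ^ n * R⁻¹ ^ 2) := by
  unfold zz
  rw [← jap_half n]
  nlinarith [sq_nonneg (zt n R v - jap v ^ (n / 2) * R⁻¹)]

lemma zt_bd (n : ℝ) : ∃ C, 0 ≤ C ∧ ∀ R, 1 ≤ R → ∀ v i j,
    |pd i (zt n R) v| ≤ C * zz n R v ∧ |pd i (pd j (zt n R)) v| ≤ C * zz n R v := by
  obtain ⟨C, hC, h⟩ := chi_bd
  set m := n / 2 with hm
  set c1 := |m|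
  set c2 := |m| * (|m - 2| + 1)
  have hc1 : 0 ≤ c1 := abs_nonneg _
  have hc2 : 0 ≤ c2 := by positivity
  refine ⟨c1 + c2 + C + 2 * (c1 * C), by positivity, fun R hR v i j => ?_⟩
  have hR0 : 0 ≤ R⁻¹ := by positivity
  have dj : ∀ v, DifferentiableAt ℝ (fun v => jap v ^ m) v := jap_diff m
  have dc : ∀ v, DifferentiableAt ℝ (chi R) v := fun v =>
    (chi_contDiff R (n := 1)).differentiable (by norm_num) v
  have ddj : ∀ j v, DifferentiableAt ℝ (pd j (fun v => jap v ^ m)) v := fun j v =>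
    (contDiff_pd (n := 1) j (jap_contDiff m)).differentiable (by norm_num) v
  have ddc : ∀ j v, DifferentiableAt ℝ (pd j (chi R)) v := fun j v =>
    (contDiff_pd (n := 1) j (chi_contDiff R)).differentiable (by norm_num) v
  have e1 : ∀ j, pd j (zt n R) = fun v => jap v ^ m * pd j (chi R) v +
      pd j (fun v => jap v ^ m) v * chi R v := fun j => by
    ext v; exact pd_mul j (dj v) (dc v)
  have hW : 0 ≤ jap v ^ m := Real.rpow_nonneg (jap_pos v).le _
  obtain ⟨x0, x1⟩ := chi_mem R v
  have A0 : |chi R v| = chi R v := abs_of_nonneg x0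
  have A1 : |jap v ^ m| = jap v ^ m := abs_of_nonneg hW
  have B1 : ∀ i, |pd i (fun v => jap v ^ m) v| ≤ c1 * jap v ^ m := fun i => pd_jap_le m i v
  have B2 := pdd_jap_le m i j v
  have B3 : ∀ i, |pd i (chi R) v| ≤ C * R⁻¹ := fun i => (h R hR v i j).1
  have B4 := (h R hR v i j).2
  have hz : zt n R v = jap v ^ m * chi R v := rfl
  have hzz : zz n R v = jap v ^ m * chi R v + jap v ^ m * R⁻¹ := rfl
  set W := jap v ^ m with hWd
  have q1 : 0 ≤ W * R⁻¹ := by positivity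
  have q2 : 0 ≤ W * chi R v := by positivity
  constructor
  · rw [e1, hzz]
    simp only
    calc _ ≤ |W * pd i (chi R) v| + |pd i (fun v => jap v ^ m) v * chi R v| := abs_add_le _ _
      _ = W * |pd i (chi R) v| + |pd i (fun v => jap v ^ m) v| * chi R v := by
        rw [abs_mul, abs_mul, A0, A1]
      _ ≤ W * (C * R⁻¹) + c1 * W * chi R v := by gcongr; exact B3 i; exact B1 i
      _ = C * (W * R⁻¹) + c1 * (W * chi R v) := by ring
      _ ≤ _ := by
        have := mul_nonneg hc1 q1
        have := mul_nonneg hc2 q1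
        have := mul_nonneg hc2 q2
        have := mul_nonneg hC q2
        have := mul_nonneg (mul_nonneg hc1 hC) q1
        have := mul_nonneg (mul_nonneg hc1 hC) q2
        nlinarith
  · rw [e1, pd_add i ((dj v).fun_mul (ddc j v)) ((ddj j v).fun_mul (dc v)), pd_mul i (dj v) (ddc j v),
      pd_mul i (ddj j v) (dc v), hzz]
    calc _ ≤ (|W * pd i (pd j (chi R)) v| + |pd i (fun v => jap v ^ m) v * pd j (chi R) v|) +
          (|pd j (fun v => jap v ^ m) v * pd i (chi R) v| +
            |pd i (pd j (fun v => jap v ^ m)) v * chi R v|) :=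
          (abs_add_le _ _).trans (add_le_add (abs_add_le _ _) (abs_add_le _ _))
      _ = (W * |pd i (pd j (chi R)) v| + |pd i (fun v => jap v ^ m) v| * |pd j (chi R) v|) +
          (|pd j (fun v => jap v ^ m) v| * |pd i (chi R) v| +
            |pd i (pd j (fun v => jap v ^ m)) v| * chi R v) := by
        rw [abs_mul, abs_mul, abs_mul, abs_mul, A0, A1]
      _ ≤ (W * (C * R⁻¹) + c1 * W * (C * R⁻¹)) + (c1 * W * (C * R⁻¹) + c2 * W * chi R v) := by
        gcongr
        · exact B1 i
        · exact B3 j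
        · exact B1 j
        · exact B3 i
      _ = C * (W * R⁻¹) + 2 * (c1 * C) * (W * R⁻¹) + c2 * (W * chi R v) := by ring
      _ ≤ _ := by
        have := mul_nonneg hc1 q1
        have := mul_nonneg hc1 q2
        have := mul_nonneg hc2 q1
        have := mul_nonneg hC q2
        have := mul_nonneg (mul_nonneg hc1 hC) q1
        have := mul_nonneg (mul_nonneg hc1 hC) q2
        nlinarith

end MPB

namespace MPB

lemma plus_nonneg (x : ℝ) : 0 ≤ plus x := le_max_right _ _
lemma plus_of_nonneg {x : ℝ} (h : 0 ≤ x) : plus x = x := max_eq_left h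
lemma plus_of_nonpos {x : ℝ} (h : x ≤ 0) : plus x = 0 := max_eq_right h
lemma plus_cont : Continuous plus := continuous_id.max continuous_const

lemma plus_pow_deriv (m : ℕ) (x : ℝ) :
    HasDerivAt (fun y => plus y ^ (m + 2)) ((m + 2 : ℕ) * plus x ^ (m + 1)) x := by
  rcases lt_trichotomy x 0 with h | h | h
  · rw [plus_of_nonpos h.le]
    have : HasDerivAt (fun _ : ℝ => (0 : ℝ)) 0 x := hasDerivAt_const _ _
    have h2 : HasDerivAt (fun y => plus y ^ (m + 2)) 0 x := by
      refine this.congr_of_eventuallyEq ?_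
      filter_upwards [Iio_mem_nhds h] with y hy
      rw [plus_of_nonpos (le_of_lt hy)]; simp
    exact h2.congr_deriv (by simp)
  · subst h
    rw [plus_of_nonpos le_rfl]
    rw [hasDerivAt_iff_isLittleO_nhds_zero]
    simp only [zero_add, plus_of_nonpos le_rfl]
    have : (fun y : ℝ => y ^ (m + 2)) =o[nhds 0] fun y => y := by
      simpa using Asymptotics.isLittleO_pow_pow (𝕜 := ℝ) (m := 1) (n := m + 2) (by omega)
    refine Asymptotics.IsBigO.trans_isLittleO ?_ this
    refine Asymptotics.IsBigO.of_bound 1 (Filter.Eventually.of_forall fun y => ?_)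
    simp only [ne_eq, Nat.add_eq_zero_iff, one_ne_zero, and_false, not_false_eq_true, zero_pow,
      mul_zero, smul_zero, sub_zero, one_mul, OfNat.ofNat_ne_zero, norm_pow]
    refine pow_le_pow_left₀ (norm_nonneg _) ?_ _
    rw [Real.norm_eq_abs, Real.norm_eq_abs, abs_of_nonneg (plus_nonneg y)]
    exact max_le (le_abs_self _) (abs_nonneg _)
  · rw [plus_of_nonneg h.le]
    have : HasDerivAt (fun y : ℝ => y ^ (m + 2)) ((m + 2 : ℕ) * x ^ (m + 1)) x := by
      simpa using hasDerivAt_pow (m + 2) x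
    refine this.congr_of_eventuallyEq ?_
    filter_upwards [Ioi_mem_nhds h] with y hy
    rw [plus_of_nonneg (le_of_lt hy)]

lemma plus_cube_contDiff : ContDiff ℝ 2 (fun y => plus y ^ 3) := by
  have h2 : ContDiff ℝ 1 (fun y => plus y ^ 2) := by
    rw [contDiff_one_iff_deriv]
    refine ⟨fun x => (plus_pow_deriv 0 x).differentiableAt, ?_⟩
    have : deriv (fun y => plus y ^ 2) = fun x => ((0 + 2 : ℕ) : ℝ) * plus x ^ (0 + 1) :=
      funext fun x => (plus_pow_deriv 0 x).deriv
    rw [this]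
    exact continuous_const.mul (plus_cont.pow _)
  have : (2 : WithTop ℕ∞) = 1 + 1 := by norm_num
  rw [this, contDiff_succ_iff_deriv]
  refine ⟨fun x => (plus_pow_deriv 1 x).differentiableAt, by simp, ?_⟩
  have : deriv (fun y => plus y ^ 3) = fun x => ((1 + 2 : ℕ) : ℝ) * plus x ^ (1 + 1) :=
    funext fun x => (plus_pow_deriv 1 x).deriv
  rw [this]
  exact contDiff_const.mul h2

def b0 (ε x : ℝ) : ℝ := plus x ^ 3 * (x ^ 2 + ε) ^ (-(3 / 4) : ℝ)
def b1 (ε x : ℝ) : ℝ := plus x ^ 2 * ((x ^ 2 + ε) ^ (-(7 / 4) : ℝ) * (3 / 2 * x ^ 2 + 3 * ε))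
def b2 (ε x : ℝ) : ℝ :=
  plus x * ((x ^ 2 + ε) ^ (-(11 / 4) : ℝ) * (3 / 4 * x ^ 4 + 3 / 2 * x ^ 2 * ε + 6 * ε ^ 2))

lemma q_pos {ε : ℝ} (hε : 0 < ε) (x : ℝ) : 0 < x ^ 2 + ε := by positivity

lemma q_rpow_deriv {ε : ℝ} (hε : 0 < ε) (r x : ℝ) : HasDerivAt (fun y => (y ^ 2 + ε) ^ r)
    (r * (2 * x) * (x ^ 2 + ε) ^ (r - 1)) x := by
  have h1 : HasDerivAt (fun y : ℝ => y ^ 2 + ε) (2 * x) x := by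
    simpa using (hasDerivAt_pow 2 x).add_const ε
  exact (h1.rpow_const (p := r) (Or.inl (q_pos hε x).ne')).congr_deriv (by ring)

lemma q34 {ε : ℝ} (hε : 0 < ε) (x : ℝ) :
    (x ^ 2 + ε) ^ (-(3 / 4) : ℝ) = (x ^ 2 + ε) ^ (-(7 / 4) : ℝ) * (x ^ 2 + ε) := by
  rw [show (-(3 / 4) : ℝ) = -(7 / 4) + 1 by norm_num, rpow_add (q_pos hε x), rpow_one]
lemma q74 {ε : ℝ} (hε : 0 < ε) (x : ℝ) :
    (x ^ 2 + ε) ^ (-(7 / 4) : ℝ) = (x ^ 2 + ε) ^ (-(11 / 4) : ℝ) * (x ^ 2 + ε) := by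
  rw [show (-(7 / 4) : ℝ) = -(11 / 4) + 1 by norm_num, rpow_add (q_pos hε x), rpow_one]

lemma b0_contDiff {ε : ℝ} (hε : 0 < ε) : ContDiff ℝ 2 (b0 ε) := by
  unfold b0
  refine plus_cube_contDiff.mul ?_
  refine ContDiff.rpow_const_of_ne (by fun_prop) fun x => (q_pos hε x).ne'

lemma plus_mul_self (x : ℝ) : plus x * x = plus x ^ 2 := by
  rcases le_total x 0 with h | h
  · rw [plus_of_nonpos h]; simp
  · rw [plus_of_nonneg h]; ring

lemma b0_deriv {ε : ℝ} (hε : 0 < ε) (x : ℝ) : HasDerivAt (b0 ε) (b1 ε x) x := by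
  refine HasDerivAt.congr_deriv
    ((plus_pow_deriv 1 x).fun_mul (q_rpow_deriv hε (-(3 / 4)) x)) ?_
  rw [show (-(3 / 4) - 1 : ℝ) = -(7 / 4) by norm_num, q34 hε, b1]
  have := plus_mul_self x
  push_cast
  have e : plus x ^ 3 * x = plus x ^ 2 * x ^ 2 := by
    linear_combination (-plus x * x) * this
  linear_combination (-3/2) * (x ^ 2 + ε) ^ (-(7 / 4) : ℝ) * e

lemma b1_deriv {ε : ℝ} (hε : 0 < ε) (x : ℝ) : HasDerivAt (b1 ε) (b2 ε x) x := by
  have h1 : HasDerivAt (fun y : ℝ => 3 / 2 * y ^ 2 + 3 * ε) (3 * x) x := by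
    refine (((hasDerivAt_pow 2 x).const_mul (3 / 2)).add_const (3 * ε)).congr_deriv ?_
    push_cast; ring
  refine HasDerivAt.congr_deriv
    ((plus_pow_deriv 0 x).fun_mul ((q_rpow_deriv hε (-(7 / 4)) x).fun_mul h1)) ?_
  rw [show (-(7 / 4) - 1 : ℝ) = -(11 / 4) by norm_num, q74 hε, b2]
  have := plus_mul_self x
  push_cast
  have e : plus x ^ 2 * x = plus x * x ^ 2 := by
    linear_combination (-x) * this
  linear_combination ((x ^ 2 + ε) ^ (-(11 / 4) : ℝ) * (3 * (x ^ 2 + ε) - 7 / 2 * (3 / 2 * x ^ 2 + 3 * ε))) * e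

lemma b0_nonneg {ε : ℝ} (hε : 0 < ε) (x : ℝ) : 0 ≤ b0 ε x :=
  mul_nonneg (pow_nonneg (plus_nonneg x) _) (rpow_nonneg (q_pos hε x).le _)
lemma b1_nonneg {ε : ℝ} (hε : 0 < ε) (x : ℝ) : 0 ≤ b1 ε x :=
  mul_nonneg (pow_nonneg (plus_nonneg x) _) (mul_nonneg (rpow_nonneg (q_pos hε x).le _) (by positivity))
lemma b2_nonneg {ε : ℝ} (hε : 0 < ε) (x : ℝ) : 0 ≤ b2 ε x :=
  mul_nonneg (plus_nonneg x) (mul_nonneg (rpow_nonneg (q_pos hε x).le _) (by positivity))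

lemma b0_nonpos (ε : ℝ) {x : ℝ} (hx : x ≤ 0) : b0 ε x = 0 := by simp [b0, plus_of_nonpos hx]
lemma b1_nonpos (ε : ℝ) {x : ℝ} (hx : x ≤ 0) : b1 ε x = 0 := by simp [b1, plus_of_nonpos hx]
lemma b2_nonpos (ε : ℝ) {x : ℝ} (hx : x ≤ 0) : b2 ε x = 0 := by simp [b2, plus_of_nonpos hx]

lemma b0_le {ε : ℝ} (hε : 0 < ε) {x : ℝ} (hx : 0 ≤ x) : b0 ε x ≤ x * b1 ε x := by
  rw [b0, b1, q34 hε, plus_of_nonneg hx]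
  have := rpow_nonneg (q_pos hε x).le (-(7 / 4))
  have : 0 ≤ x ^ 3 * (x ^ 2 + ε) ^ (-(7 / 4) : ℝ) * (1 / 2 * x ^ 2 + 2 * ε) := by positivity
  linarith

lemma b1_le {ε : ℝ} (hε : 0 < ε) {x : ℝ} (hx : 0 ≤ x) : b1 ε x ≤ 4 * x * b2 ε x := by
  rw [b1, b2, q74 hε, plus_of_nonneg hx]
  have := rpow_nonneg (q_pos hε x).le (-(11 / 4))
  have : 0 ≤ x ^ 2 * (x ^ 2 + ε) ^ (-(11 / 4) : ℝ) * (3 / 2 * x ^ 4 + 3 / 2 * x ^ 2 * ε + 21 * ε ^ 2) := by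
    positivity
  linarith

lemma q34_le {ε : ℝ} (hε : 0 < ε) {x : ℝ} (hx : 0 < x) :
    (x ^ 2 + ε) ^ (-(3 / 4) : ℝ) ≤ x ^ (-(3 / 2) : ℝ) := by
  have : x ^ (-(3 / 2) : ℝ) = (x ^ 2) ^ (-(3 / 4) : ℝ) := by
    rw [← rpow_natCast, ← rpow_mul hx.le]; norm_num
  rw [this]
  exact rpow_le_rpow_of_nonpos (by positivity) (by linarith) (by norm_num)

lemma b1_le_sqrt {ε : ℝ} (hε : 0 < ε) {x c : ℝ} (hx : x ≤ c) (hc : 0 < c) :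
    b1 ε x ≤ 3 * c ^ (1 / 2 : ℝ) := by
  rcases le_or_gt x 0 with h | h
  · rw [b1_nonpos ε h]; positivity
  · have h1 : b1 ε x ≤ 3 * x ^ 2 * (x ^ 2 + ε) ^ (-(3 / 4) : ℝ) := by
      rw [b1, q34 hε, plus_of_nonneg h.le]
      have := rpow_nonneg (q_pos hε x).le (-(7 / 4))
      have : 0 ≤ x ^ 2 * (x ^ 2 + ε) ^ (-(7 / 4) : ℝ) * (3 / 2 * x ^ 2) := by positivity
      linarith
    have h2 : x ^ 2 * x ^ (-(3 / 2) : ℝ) = x ^ (1 / 2 : ℝ) := by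
      rw [← rpow_natCast, ← rpow_add h]; norm_num
    have h3 : x ^ (1 / 2 : ℝ) ≤ c ^ (1 / 2 : ℝ) := rpow_le_rpow h.le hx (by norm_num)
    have h4 := mul_le_mul_of_nonneg_left (q34_le hε h) (by positivity : 0 ≤ 3 * x ^ 2)
    linarith

lemma b0_le_rpow {ε : ℝ} (hε : 0 < ε) (x : ℝ) : b0 ε x ≤ plus x ^ (3 / 2 : ℝ) := by
  rcases le_or_gt x 0 with h | h
  · rw [b0_nonpos ε h]; exact rpow_nonneg (plus_nonneg _) _
  · rw [b0, plus_of_nonneg h.le]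
    have h2 : x ^ 3 * x ^ (-(3 / 2) : ℝ) = x ^ (3 / 2 : ℝ) := by
      rw [← rpow_natCast, ← rpow_add h]; norm_num
    rw [← h2]
    exact mul_le_mul_of_nonneg_left (q34_le hε h) (by positivity)

lemma b0_tendsto {e : ℕ → ℝ} (he : Filter.Tendsto e Filter.atTop (nhds 0)) (x : ℝ) :
    Filter.Tendsto (fun m => b0 (e m) x) Filter.atTop (nhds (plus x ^ (3 / 2 : ℝ))) := by
  rcases le_or_gt x 0 with h | h
  · simp only [b0_nonpos _ h, plus_of_nonpos h]
    rw [zero_rpow (by norm_num)]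
    exact tendsto_const_nhds
  · have h2 : x ^ 3 * (x ^ 2 + 0) ^ (-(3 / 4) : ℝ) = x ^ (3 / 2 : ℝ) := by
      rw [add_zero, ← rpow_natCast x 2, ← rpow_mul h.le, ← rpow_natCast, ← rpow_add h]; norm_num
    unfold b0
    rw [plus_of_nonneg h.le, ← h2]
    refine Filter.Tendsto.const_mul _ ?_
    exact (tendsto_const_nhds.add he).rpow_const (Or.inl (by positivity))

end MPB

namespace MPB

/-- bilinear form -/
def bf (A : Matrix (Fin 3) (Fin 3) ℝ) (x y : Fin 3 → ℝ) : ℝ := ∑ i, ∑ j, A i j * x i * y j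
/-- contraction -/
def ct (A : Matrix (Fin 3) (Fin 3) ℝ) (B : Fin 3 → Fin 3 → ℝ) : ℝ := ∑ i, ∑ j, A i j * B i j

lemma ct_bound {A : Matrix (Fin 3) (Fin 3) ℝ} {B : Fin 3 → Fin 3 → ℝ} {N b : ℝ}
    (hA : ∀ i j, |A i j| ≤ N) (hB : ∀ i j, |B i j| ≤ b) : |ct A B| ≤ 9 * (N * b) := by
  have hN : 0 ≤ N := (abs_nonneg _).trans (hA 0 0)
  unfold ct
  refine (Finset.abs_sum_le_sum_abs _ _).trans ?_
  have : ∀ i ∈ (Finset.univ : Finset (Fin 3)), |∑ j, A i j * B i j| ≤ 3 * (N * b) := by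
    intro i _
    refine (Finset.abs_sum_le_sum_abs _ _).trans ?_
    have : ∀ j ∈ (Finset.univ : Finset (Fin 3)), |A i j * B i j| ≤ N * b := by
      intro j _
      rw [abs_mul]
      exact mul_le_mul (hA i j) (hB i j) (abs_nonneg _) hN
    refine (Finset.sum_le_sum this).trans ?_
    simp
  refine (Finset.sum_le_sum this).trans ?_
  simp; linarith

lemma bf_eq_ct (A : Matrix (Fin 3) (Fin 3) ℝ) (x y : Fin 3 → ℝ) :
    bf A x y = ct A (fun i j => x i * y j) := by
  unfold bf ct
  simp only [mul_assoc]

lemma alg1 {A : Matrix (Fin 3) (Fin 3) ℝ} (sym : ∀ i j, A i j = A j i)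
    (g W : ℝ) (g1 W1 L u1 : Fin 3 → ℝ) (g2 W2 u2 : Fin 3 → Fin 3 → ℝ)
    (hW : ∀ i, W1 i = L i * W) (h1 : ∀ j, u1 j = -(g * W1 j + g1 j * W))
    (h2 : ∀ i j, u2 i j = -(g * W2 i j + g1 i * W1 j + (g1 j * W1 i + g2 i j * W))) :
    -(W * ct A g2) = ct A u2 - 2 * bf A L u1 - 2 * (g * W) * bf A L L + g * ct A W2 := by
  unfold ct bf
  simp only [Fin.sum_univ_three, h1, h2, hW, sym 1 0, sym 2 0, sym 2 1]
  ring

lemma alg2 {A : Matrix (Fin 3) (Fin 3) ℝ} (sym : ∀ i j, A i j = A j i)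
    (psd : ∀ ξ, 0 ≤ bf A ξ ξ) (z β1 β2 u : ℝ) (Y p : Fin 3 → ℝ) (hu : 0 ≤ u) (h1 : 0 ≤ β1)
    (h2 : 0 ≤ β2) (h3 : β1 ≤ 4 * u * β2) :
    -2 * z * β1 * bf A Y p - z ^ 2 * β2 * bf A p p ≤ 4 * u * β1 * bf A Y Y := by
  rcases h2.eq_or_lt with h | h
  · have : β1 = 0 := le_antisymm (by rw [← h] at h3; simpa using h3) h1
    rw [← h, this]; simp
  · have key : bf A (fun i => z * β2 * p i + β1 * Y i) (fun i => z * β2 * p i + β1 * Y i) =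
      β2 * (z ^ 2 * β2 * bf A p p + 2 * z * β1 * bf A Y p) + β1 ^ 2 * bf A Y Y := by
      unfold bf
      simp only [Fin.sum_univ_three, sym 1 0, sym 2 0, sym 2 1]
      ring
    have k1 := psd (fun i => z * β2 * p i + β1 * Y i)
    rw [key] at k1
    have k2 : β1 * (β1 * bf A Y Y) ≤ (4 * u * β2) * (β1 * bf A Y Y) :=
      mul_le_mul_of_nonneg_right h3 (mul_nonneg h1 (psd Y))
    by_contra hc
    push Not at hc
    have := mul_lt_mul_of_pos_left hc h
    linarith

/-- pointwise final bound -/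
lemma alg3 {A : Matrix (Fin 3) (Fin 3) ℝ} (sym : ∀ i j, A i j = A j i)
    (psd : ∀ ξ, 0 ≤ bf A ξ ξ) {N C D k c c' z Z g W u ε : ℝ} (hε : 0 < ε)
    (hA : ∀ i j, |A i j| ≤ N) (hC : 0 ≤ C) (hk : 0 ≤ k) (hD : 0 ≤ D) (hc : 0 < c)
    (hz : 0 ≤ z) (hzZ : z ≤ Z) (hg : 0 ≤ g) (hW : 0 ≤ W) (hu : u = c - g * W)
    (z1 L u1 : Fin 3 → ℝ) (z2 W2 : Fin 3 → Fin 3 → ℝ)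
    (hz1 : ∀ i, |z1 i| ≤ C * Z) (hz2 : ∀ i j, |z2 i j| ≤ C * Z) (hL : ∀ i, |L i| ≤ k)
    (hW2 : ∀ i j, |W2 i j| ≤ D * W) :
    (-2 * (∑ i, ∑ j, A i j * (2 * z * z1 i) * (b1 ε u * u1 j)) -
      (∑ i, ∑ j, A i j * (2 * z1 i * z1 j + 2 * z * z2 i j)) * b0 ε u) +
      z ^ 2 * (-(b2 ε u * bf A u1 u1) +
        b1 ε u * (- 2 * bf A L u1 + g * ct A W2 + c')) ≤
    b1 ε u * (z ^ 2 * c' +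
      9 * (4 * (2 * C + k) ^ 2 + (2 * C ^ 2 + 2 * C) + D) * (c * N) * Z ^ 2) := by
  rcases le_or_gt u 0 with h | h
  · rw [b0_nonpos ε h, b1_nonpos ε h, b2_nonpos ε h]; simp
  have hZ : 0 ≤ Z := hz.trans hzZ
  have hN : 0 ≤ N := (abs_nonneg _).trans (hA 0 0)
  have hgW : 0 ≤ g * W := mul_nonneg hg hW
  have huc : u ≤ c := by linarith
  have hb1 := b1_nonneg hε u
  have hb0 := b0_nonneg hε u
  set Y : Fin 3 → ℝ := fun i => 2 * z1 i + z * L i with hY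
  have e1 := alg2 sym psd z (b1 ε u) (b2 ε u) u Y u1 h.le hb1 (b2_nonneg hε u) (b1_le hε h.le)
  have e2 : ∀ i, |Y i| ≤ (2 * C + k) * Z := by
    intro i
    have i1 : |z * L i| ≤ Z * k := by
      rw [abs_mul, abs_of_nonneg hz]
      exact mul_le_mul hzZ (hL i) (abs_nonneg _) hZ
    have i2 : |2 * z1 i| ≤ 2 * (C * Z) := by
      rw [abs_mul, abs_of_nonneg (by norm_num : (0:ℝ) ≤ 2)]
      linarith [hz1 i]
    calc |Y i| ≤ |2 * z1 i| + |z * L i| := abs_add_le _ _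
      _ ≤ _ := by linarith
  have e3 : bf A Y Y ≤ 9 * (N * (((2 * C + k) * Z) * ((2 * C + k) * Z))) := by
    rw [bf_eq_ct]
    refine (le_abs_self _).trans (ct_bound hA fun i j => ?_)
    rw [abs_mul]
    exact mul_le_mul (e2 i) (e2 j) (abs_nonneg _) (by positivity)
  have e4 : |ct A (fun i j => 2 * z1 i * z1 j + 2 * z * z2 i j)| ≤
      9 * (N * ((2 * C ^ 2 + 2 * C) * Z ^ 2)) := by
    refine ct_bound hA fun i j => ?_
    have i1 : |z1 i * z1 j| ≤ (C * Z) * (C * Z) := by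
      rw [abs_mul]; exact mul_le_mul (hz1 i) (hz1 j) (abs_nonneg _) (by positivity)
    have i2 : |z * z2 i j| ≤ Z * (C * Z) := by
      rw [abs_mul, abs_of_nonneg hz]; exact mul_le_mul hzZ (hz2 i j) (abs_nonneg _) hZ
    rw [abs_le] at i1 i2 ⊢
    constructor <;> nlinarith
  have e5 : |ct A W2| ≤ 9 * (N * (D * W)) := ct_bound hA hW2
  have e6 : -2 * (∑ i, ∑ j, A i j * (2 * z * z1 i) * (b1 ε u * u1 j)) - 2 * z ^ 2 * b1 ε u * bf A L u1
      = -2 * z * b1 ε u * bf A Y u1 := by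
    unfold bf
    simp only [Fin.sum_univ_three, hY]; ring
  have e7 : -(ct A (fun i j => 2 * z1 i * z1 j + 2 * z * z2 i j)) * b0 ε u ≤
      (9 * (N * ((2 * C ^ 2 + 2 * C) * Z ^ 2))) * (c * b1 ε u) := by
    have i1 : b0 ε u ≤ c * b1 ε u := (b0_le hε h.le).trans (mul_le_mul_of_nonneg_right huc hb1)
    calc _ ≤ |ct A (fun i j => 2 * z1 i * z1 j + 2 * z * z2 i j)| * b0 ε u :=
          mul_le_mul_of_nonneg_right (neg_le_abs _) hb0
      _ ≤ _ := mul_le_mul e4 i1 hb0 (by positivity)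
  have e8 : z ^ 2 * (b1 ε u * (g * ct A W2)) ≤ Z ^ 2 * (b1 ε u * (9 * (N * (D * c)))) := by
    have i1 : g * ct A W2 ≤ 9 * (N * (D * c)) := by
      calc g * ct A W2 ≤ g * (9 * (N * (D * W))) :=
            mul_le_mul_of_nonneg_left ((le_abs_self _).trans e5) hg
        _ = 9 * (N * (D * (g * W))) := by ring
        _ ≤ _ := by gcongr; linarith
    calc z ^ 2 * (b1 ε u * (g * ct A W2)) ≤ z ^ 2 * (b1 ε u * (9 * (N * (D * c)))) := by gcongr
      _ ≤ _ := by gcongr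
  have e9 : 4 * u * b1 ε u * bf A Y Y ≤
      4 * c * b1 ε u * (9 * (N * (((2 * C + k) * Z) * ((2 * C + k) * Z)))) := by
    refine mul_le_mul ?_ e3 (psd Y) (by positivity)
    gcongr
  have e10 : (∑ i, ∑ j, A i j * (2 * z1 i * z1 j + 2 * z * z2 i j)) =
    ct A (fun i j => 2 * z1 i * z1 j + 2 * z * z2 i j) := rfl
  rw [e10]
  linarith

end MPB

namespace MPB

lemma landau_expand {A : V3 → Matrix (Fin 3) (Fin 3) ℝ} {α g : V3 → ℝ} (H : Good A α)
    (cg : ContDiff ℝ 2 g) (v : V3) :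
    ∑ i : Fin 3, pd i (fun u => (∑ j : Fin 3, A u i j * pd j g u) - pd i α u * g u) v =
      ct (A v) (fun i j => pd i (pd j g) v) - g v * ∑ i, pd i (pd i α) v := by
  have dA : ∀ i j, DifferentiableAt ℝ (fun u => A u i j) v := fun i j =>
    (H.cA i j).differentiable one_ne_zero v
  have dg : DifferentiableAt ℝ g v := cg.differentiable two_ne_zero v
  have dg1 : ∀ j, DifferentiableAt ℝ (pd j g) v := fun j =>
    (contDiff_pd (n := 1) j cg).differentiable one_ne_zero v
  have da1 : ∀ j, DifferentiableAt ℝ (pd j α) v := fun j =>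
    (contDiff_pd (n := 1) j H.cα).differentiable one_ne_zero v
  have e : ∀ i, pd i (fun u => (∑ j : Fin 3, A u i j * pd j g u) - pd i α u * g u) v =
      ∑ j, (A v i j * pd i (pd j g) v + pd i (fun u => A u i j) v * pd j g v) -
        (pd i α v * pd i g v + pd i (pd i α) v * g v) := by
    intro i
    rw [pd_sub i (DifferentiableAt.fun_sum fun j _ => (dA i j).fun_mul (dg1 j)) ((da1 i).fun_mul dg),
      pd_sum _ i (fun j _ => (dA i j).fun_mul (dg1 j)), pd_mul i (da1 i) dg]
    congr 1
    exact Finset.sum_congr rfl fun j _ => pd_mul i (dA i j) (dg1 j)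
  simp only [e]
  have hd : ∀ j, pd j α v = _ := fun j => (H.div j v).symm
  have h0 := H.div 0 v
  have h1 := H.div 1 v
  have h2 := H.div 2 v
  unfold ct
  simp only [Fin.sum_univ_three] at *
  rw [← h0, ← h1, ← h2]
  ring

lemma int_of {F : V3 → ℝ} (ω G : V3 → ℝ) (h : F = fun v => ω v * G v)
    (hω : Continuous ω) (s : HasCompactSupport ω) (hG : Continuous G) : Integrable F := by
  subst h
  exact (hω.mul hG).integrable_of_hasCompactSupport s.mul_right

lemma ct_cont {A : V3 → Matrix (Fin 3) (Fin 3) ℝ} {B : V3 → Fin 3 → Fin 3 → ℝ}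
    (hA : ∀ i j, Continuous fun v => A v i j) (hB : ∀ i j, Continuous fun v => B v i j) :
    Continuous fun v => ct (A v) (B v) := by
  unfold ct
  exact continuous_finsetSum _ fun i _ => continuous_finsetSum _ fun j _ => (hA i j).mul (hB i j)

lemma spatial (n k : ℝ) (hn : n < -3) (hk : 0 < k) : ∃ K, 0 ≤ K ∧
    ∀ (A : V3 → Matrix (Fin 3) (Fin 3) ℝ) (α g : V3 → ℝ), Good A α → ContDiff ℝ 2 g →
    (∀ v, 0 ≤ g v) → ∀ N, (∀ v i j, |A v i j| ≤ N) → ∀ R, 1 ≤ R → ∀ ε, 0 < ε → ∀ c, 0 < c →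
    ∀ c', c' ≤ -(2 * K * (c * N)) →
    ∫ v, zt n R v ^ 2 * (b1 ε (c - g v * jap v ^ k) * (c' -
      (ct (A v) (fun i j => pd i (pd j g) v) - g v * ∑ i, pd i (pd i α) v) * jap v ^ k)) ≤
    3 * c ^ (1 / 2 : ℝ) * (2 * K * (c * N)) * R⁻¹ ^ 2 * ∫ v, jap v ^ n := by
  obtain ⟨C, hC, hzt⟩ := zt_bd n
  set D := |k| * (|k - 2| + 1) with hDdef
  have hD : 0 ≤ D := by positivity
  set K := 9 * (4 * (2 * C + k) ^ 2 + (2 * C ^ 2 + 2 * C) + D) with hK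
  refine ⟨K, by positivity, ?_⟩
  intro A α g H cg hg N hN R hR ε hε c hc c' hc'
  have hN0 : 0 ≤ N := (abs_nonneg _).trans (hN 0 0 0)
  set W : V3 → ℝ := fun v => jap v ^ k with hW
  set z := zt n R with hz
  have cz : ContDiff ℝ 2 z := zt_contDiff n R (m := 2)
  have cW : ContDiff ℝ 2 W := jap_contDiff k
  have hWpos : ∀ v, 0 < W v := fun v => Real.rpow_pos_of_pos (jap_pos v) _
  set u : V3 → ℝ := fun v => c - g v * W v with hu
  have cu : ContDiff ℝ 2 u := contDiff_const.sub (cg.mul cW)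
  set ω : V3 → ℝ := fun v => z v * z v with hω
  have cω : ContDiff ℝ 2 ω := cz.mul cz
  have sω : HasCompactSupport ω := (zt_hcs n hR).mul_left
  set h : V3 → ℝ := fun v => b0 ε (u v) with hh
  have ch : ContDiff ℝ 2 h := (b0_contDiff hε).comp cu
  set L : V3 → Fin 3 → ℝ := fun v i => k * (v i * jap v ^ (-2 : ℝ)) with hL
  have d0 : ∀ {F : V3 → ℝ}, ContDiff ℝ 2 F → ∀ v, DifferentiableAt ℝ F v := fun hF v =>
    hF.differentiable two_ne_zero v
  have d1 : ∀ {F : V3 → ℝ}, ContDiff ℝ 2 F → ∀ i v, DifferentiableAt ℝ (pd i F) v := fun hF i v =>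
    (contDiff_pd (n := 1) i hF).differentiable one_ne_zero v
  have k0 : ∀ {F : V3 → ℝ}, ContDiff ℝ 2 F → Continuous F := fun hF => hF.continuous
  have k1 : ∀ {F : V3 → ℝ}, ContDiff ℝ 2 F → ∀ i, Continuous (pd i F) := fun hF i =>
    (contDiff_pd (n := 1) i hF).continuous
  have k2 : ∀ {F : V3 → ℝ}, ContDiff ℝ 2 F → ∀ i j, Continuous (pd i (pd j F)) := fun hF i j =>
    (contDiff_pd (n := 0) i (contDiff_pd (n := 1) j hF)).continuous
  have kA : ∀ i j, Continuous fun v => A v i j := fun i j => (H.cA i j).continuous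
  have kb1 : Continuous (b1 ε) := by
    have : Differentiable ℝ (b1 ε) := fun x => (b1_deriv hε x).differentiableAt
    exact this.continuous
  have kb2 : Continuous (b2 ε) := by
    unfold b2
    refine plus_cont.mul (Continuous.mul ?_ (by fun_prop))
    exact Continuous.rpow_const (by fun_prop) fun x => Or.inl (q_pos hε x).ne'
  have kL : ∀ i, Continuous fun v => L v i := fun i =>
    continuous_const.mul (((contDiff_coord i (n := 0)).continuous).mul
      ((jap_contDiff (-2) (n := 0)).continuous))
  have W1 : ∀ i v, pd i W v = L v i * W v := by
    intro i v
    have : jap v ^ (k - 2) = jap v ^ (-2 : ℝ) * jap v ^ k := by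
      rw [← Real.rpow_add (jap_pos v)]; congr 1; ring
    rw [hW, pd_jap, this, hL]; ring
  have u1 : ∀ j v, pd j u v = -(g v * pd j W v + pd j g v * W v) := by
    intro j v
    rw [hu, pd_const_sub, pd_mul j (d0 cg v) (d0 cW v)]
  have u2 : ∀ i j v, pd i (pd j u) v = -(g v * pd i (pd j W) v + pd i g v * pd j W v +
      (pd j g v * pd i W v + pd i (pd j g) v * W v)) := by
    intro i j v
    have : pd j u = fun v => -(g v * pd j W v + pd j g v * W v) := funext (u1 j)
    rw [this, pd_neg, pd_add i ((d0 cg v).fun_mul (d1 cW j v)) ((d1 cg j v).fun_mul (d0 cW v)),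
      pd_mul i (d0 cg v) (d1 cW j v), pd_mul i (d1 cg j v) (d0 cW v)]
  have h1 : ∀ j v, pd j h v = b1 ε (u v) * pd j u v := fun j v =>
    pd_comp j (b0_deriv hε (u v)) (d0 cu v)
  have h2 : ∀ i j v, pd i (pd j h) v =
      b1 ε (u v) * pd i (pd j u) v + b2 ε (u v) * pd i u v * pd j u v := by
    intro i j v
    have : pd j h = fun v => b1 ε (u v) * pd j u v := funext (h1 j)
    have db : DifferentiableAt ℝ (fun v => b1 ε (u v)) v :=
      (b1_deriv hε (u v)).differentiableAt.comp v (d0 cu v)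
    rw [this, pd_mul i db (d1 cu j v), pd_comp i (b1_deriv hε (u v)) (d0 cu v)]
  have ω1 : ∀ i v, pd i ω v = 2 * z v * pd i z v := by
    intro i v
    rw [hω, pd_mul i (d0 cz v) (d0 cz v)]; ring
  have ω2 : ∀ i j v, pd i (pd j ω) v = 2 * pd i z v * pd j z v + 2 * z v * pd i (pd j z) v := by
    intro i j v
    have : pd j ω = fun v => 2 * (z v * pd j z v) := by
      funext v; rw [ω1]; ring
    rw [this, pd_const_mul i 2 ((d0 cz v).fun_mul (d1 cz j v)), pd_mul i (d0 cz v) (d1 cz j v)]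
    ring
  set P : V3 → ℝ := fun v => z v ^ 2 * (b1 ε (c - g v * jap v ^ k) * (c' -
      (ct (A v) (fun i j => pd i (pd j g) v) - g v * ∑ i, pd i (pd i α) v) * jap v ^ k)) with hP
  set Q1 : V3 → ℝ := fun v => -(b2 ε (u v) * bf (A v) (fun i => pd i u v) (fun i => pd i u v)) +
        b1 ε (u v) * (- 2 * bf (A v) (L v) (fun i => pd i u v) +
          g v * ct (A v) (fun i j => pd i (pd j W) v) + c') with hQ1
  set I1 : V3 → ℝ := fun v => ω v * ∑ i, ∑ j, A v i j * pd i (pd j h) v with hI1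
  set I2 : V3 → ℝ := fun v => (-2 * ∑ i, ∑ j, A v i j * pd i ω v * pd j h v
        - (∑ i, ∑ j, A v i j * pd i (pd j ω) v) * h v) with hI2
  have kQ1 : Continuous Q1 := by
    have b1c := kb1.comp (k0 cu)
    have b2c := kb2.comp (k0 cu)
    have f1 : Continuous fun v => bf (A v) (fun i => pd i u v) (fun i => pd i u v) := by
      simp only [bf_eq_ct]
      exact ct_cont kA fun i j => (k1 cu i).mul (k1 cu j)
    have f2 : Continuous fun v => bf (A v) (L v) (fun i => pd i u v) := by
      simp only [bf_eq_ct]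
      exact ct_cont kA fun i j => (kL i).mul (k1 cu j)
    have f3 : Continuous fun v => ct (A v) (fun i j => pd i (pd j W) v) :=
      ct_cont kA fun i j => k2 cW i j
    exact ((b2c.mul f1).neg).add (b1c.mul (((continuous_const.mul f2).add
      ((k0 cg).mul f3)).add continuous_const))
  have iP : Integrable P := by
    have f3 : Continuous fun v => ct (A v) (fun i j => pd i (pd j g) v) :=
      ct_cont kA fun i j => k2 cg i j
    have f4 : Continuous fun v => ∑ i, pd i (pd i α) v :=
      continuous_finsetSum _ fun i _ => k2 H.cα i i
    refine int_of ω (fun v => b1 ε (u v) * (c' -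
      (ct (A v) (fun i j => pd i (pd j g) v) - g v * ∑ i, pd i (pd i α) v) * W v)) ?_ (k0 cω) sω ?_
    · funext v; simp only [hP, hω, hu, hW]; ring
    · exact (kb1.comp (k0 cu)).mul (continuous_const.sub ((f3.sub ((k0 cg).mul f4)).mul (k0 cW)))
  have iQ : Integrable (fun v => ω v * Q1 v) := int_of ω Q1 rfl (k0 cω) sω kQ1
  have iI1 : Integrable I1 := int_of ω _ rfl (k0 cω) sω
    (continuous_finsetSum _ fun i _ => continuous_finsetSum _ fun j _ => (kA i j).mul (k2 ch i j))
  have iI2 : Integrable I2 := by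
    have f1 : Continuous I2 := by
      refine (continuous_const.mul (continuous_finsetSum _ fun i _ =>
        continuous_finsetSum _ fun j _ => ((kA i j).mul (k1 cω i)).mul (k1 ch j))).sub
        ((continuous_finsetSum _ fun i _ =>
        continuous_finsetSum _ fun j _ => (kA i j).mul (k2 cω i j)).mul (k0 ch))
    have sz : HasCompactSupport z := zt_hcs n hR
    refine f1.integrable_of_hasCompactSupport (HasCompactSupport.of_support_subset_isCompact sz ?_)
    intro v hv
    by_contra hc
    apply hv
    have e0 : z v = 0 := image_eq_zero_of_notMem_tsupport hc
    have e1 : ∀ i, pd i z v = 0 := fun i => by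
      have : v ∉ tsupport (fderiv ℝ z) := fun hx => hc (tsupport_fderiv_subset ℝ hx)
      unfold pd
      rw [image_eq_zero_of_notMem_tsupport this]; rfl
    simp only [hI2, ω1, ω2, e0, e1]
    simp
  have step1 : ∀ v, P v ≤ I1 v + ω v * Q1 v := by
    intro v
    have a1 := alg1 (H.sym v) (g v) (W v) (fun i => pd i g v) (fun i => pd i W v) (L v)
      (fun i => pd i u v) (fun i j => pd i (pd j g) v) (fun i j => pd i (pd j W) v)
      (fun i j => pd i (pd j u) v) (fun i => W1 i v) (fun j => u1 j v) (fun i j => u2 i j v)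
    have a2 : ∑ i, ∑ j, A v i j * pd i (pd j h) v = b1 ε (u v) * ct (A v) (fun i j => pd i (pd j u) v)
        + b2 ε (u v) * bf (A v) (fun i => pd i u v) (fun i => pd i u v) := by
      unfold ct bf
      simp only [h2, Fin.sum_univ_three]; ring
    have a3 : 0 ≤ bf (A v) (L v) (L v) := H.psd v (L v)
    have a4 := H.lap v
    have a5 := b1_nonneg hε (u v)
    have a6 : 0 ≤ ω v := mul_self_nonneg _
    have a7 : 0 ≤ ω v * b1 ε (u v) * (2 * (g v * W v) * bf (A v) (L v) (L v)) :=
      mul_nonneg (mul_nonneg a6 a5) (mul_nonneg (mul_nonneg zero_le_two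
        (mul_nonneg (hg v) (hWpos v).le)) a3)
    have a8 : ω v * b1 ε (u v) * (g v * W v) * (∑ i, pd i (pd i α) v) ≤ 0 :=
      mul_nonpos_of_nonneg_of_nonpos (mul_nonneg (mul_nonneg a6 a5)
        (mul_nonneg (hg v) (hWpos v).le)) a4
    have a9 : P v = ω v * b1 ε (u v) * (c' + -(W v * ct (A v) (fun i j => pd i (pd j g) v))) +
        ω v * b1 ε (u v) * (g v * W v) * (∑ i, pd i (pd i α) v) := by
      simp only [hP, hω, hu, hW]; ring
    have a10 : I1 v + ω v * Q1 v = ω v * b1 ε (u v) * (c' + (ct (A v) (fun i j => pd i (pd j u) v)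
      - 2 * bf (A v) (L v) (fun i => pd i u v) + g v * ct (A v) (fun i j => pd i (pd j W) v))) := by
      simp only [hI1, hQ1, a2]; ring
    rw [a9, a10, a1]
    linarith
  have step2 : ∀ v, I2 v + ω v * Q1 v ≤
      3 * c ^ (1 / 2 : ℝ) * (2 * K * (c * N)) * R⁻¹ ^ 2 * jap v ^ n := by
    intro v
    have R0 : 0 < R⁻¹ := by positivity
    have zzz : z v ≤ zz n R v := by
      unfold zz
      have : 0 ≤ jap v ^ (n / 2) * R⁻¹ := mul_nonneg (Real.rpow_nonneg (jap_pos v).le _) R0.le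
      linarith
    have Lb : ∀ i, |L v i| ≤ k := by
      intro i
      have e : L v i * W v = pd i W v := (W1 i v).symm
      have := pd_jap_le k i v
      rw [abs_of_pos hk] at this
      have t2 : |L v i| * W v ≤ k * W v := by
        rw [← abs_of_pos (hWpos v), ← abs_mul, abs_of_pos (hWpos v), e]; exact this
      exact le_of_mul_le_mul_right t2 (hWpos v)
    have a1 := alg3 (H.sym v) (H.psd v) (c' := c') hε (hN v) hC hk.le hD hc (zt_nonneg n R v) zzz (hg v)
      (hWpos v).le (rfl : u v = _) (fun i => pd i z v) (L v) (fun i => pd i u v)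
      (fun i j => pd i (pd j z) v) (fun i j => pd i (pd j W) v)
      (fun i => (hzt R hR v i i).1) (fun i j => (hzt R hR v i j).2) Lb
      (fun i j => pdd_jap_le k i j v)
    have a2 : I2 v + ω v * Q1 v ≤ b1 ε (u v) * (zt n R v ^ 2 * c' + K * (c * N) * zz n R v ^ 2) := by
      refine le_trans (le_of_eq ?_) a1
      have q : ω v = zt n R v ^ 2 := (pow_two _).symm
      have q2 : h v = b0 ε (u v) := rfl
      simp only [hI2, hQ1, h1, ω1, ω2, q, q2, ← hz]
    refine a2.trans ?_
    have a5 := b1_nonneg hε (u v)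
    have a6 : zt n R v ^ 2 * c' + K * (c * N) * zz n R v ^ 2 ≤ 2 * K * (c * N) * (R⁻¹ ^ 2 * jap v ^ n) := by
      have q1 := mul_le_mul_of_nonneg_left (zz_sq (n := n) (R := R) v)
        (by positivity : 0 ≤ K * (c * N))
      have q2 := mul_le_mul_of_nonneg_left hc' (sq_nonneg (zt n R v))
      linarith
    have a7 : b1 ε (u v) ≤ 3 * c ^ (1 / 2 : ℝ) := b1_le_sqrt hε (by
      have := mul_nonneg (hg v) (hWpos v).le
      simp only [hu]; linarith) hc
    have jn : 0 ≤ jap v ^ n := Real.rpow_nonneg (jap_pos v).le _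
    calc _ ≤ b1 ε (u v) * (2 * K * (c * N) * (R⁻¹ ^ 2 * jap v ^ n)) :=
          mul_le_mul_of_nonneg_left a6 a5
      _ ≤ 3 * c ^ (1 / 2 : ℝ) * (2 * K * (c * N) * (R⁻¹ ^ 2 * jap v ^ n)) :=
          mul_le_mul_of_nonneg_right a7 (by positivity)
      _ = _ := by ring
  calc ∫ v, P v ≤ ∫ v, (I1 v + ω v * Q1 v) := integral_mono iP (iI1.add iQ) step1
    _ = (∫ v, I1 v) + ∫ v, ω v * Q1 v := integral_add iI1 iQ
    _ ≤ (∫ v, I2 v) + ∫ v, ω v * Q1 v := by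
        refine add_le_add ?_ le_rfl
        exact ibp_core H cω sω (fun v => mul_self_nonneg _) ch (fun v => b0_nonneg hε _)
    _ = ∫ v, (I2 v + ω v * Q1 v) := (integral_add iI2 iQ).symm
    _ ≤ ∫ v, 3 * c ^ (1 / 2 : ℝ) * (2 * K * (c * N)) * R⁻¹ ^ 2 * jap v ^ n :=
        integral_mono (iI2.add iQ) ((jap_int hn).const_mul _) step2
    _ = _ := integral_const_mul _ _

end MPB

namespace MPB

lemma entry_le (M : Matrix (Fin 3) (Fin 3) ℝ) (i j : Fin 3) :
    |M i j| ≤ ‖Matrix.toEuclideanCLM (𝕜 := ℝ) M‖ := by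
  have h := (Matrix.toEuclideanCLM (𝕜 := ℝ) M).le_opNorm (EuclideanSpace.single j 1)
  have h2 := abs_coord_le (Matrix.toEuclideanCLM (𝕜 := ℝ) M (EuclideanSpace.single j 1)) i
  have h3 : (Matrix.toEuclideanCLM (𝕜 := ℝ) M (EuclideanSpace.single j 1)) i = M i j := by
    rw [Matrix.ofLp_toEuclideanCLM]
    simp
  rw [h3] at h2
  simp at h
  exact h2.trans h

lemma ainf_bdd (φ : SchwartzMap V3 ℝ) :
    BddAbove (Set.range fun v => ‖Matrix.toEuclideanCLM (𝕜 := ℝ) (Amat φ v)‖) := by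
  have h : ∀ i j, ∃ C, ∀ v, |Amat φ v i j| ≤ C := fun i j => by
    obtain ⟨C, hC⟩ := pc_bdd (ker_kA i j) φ
    exact ⟨C, fun v => by rw [Amat_eq]; exact hC v⟩
  choose C hC using h
  refine ⟨∑ i, ∑ j, C i j * ‖Matrix.toEuclideanCLM (𝕜 := ℝ) (Matrix.single i j (1:ℝ) : Matrix (Fin 3) (Fin 3) ℝ)‖, ?_⟩
  rintro _ ⟨v, rfl⟩
  have e : Amat φ v = ∑ i, ∑ j, (Amat φ v i j) • (Matrix.single i j (1:ℝ) : Matrix (Fin 3) (Fin 3) ℝ) := by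
    conv_lhs => rw [Matrix.matrix_eq_sum_single (Amat φ v)]
    simp
  simp only
  rw [e]
  simp only [map_sum, map_smul]
  refine (norm_sum_le _ _).trans (Finset.sum_le_sum fun i _ => ?_)
  refine (norm_sum_le _ _).trans (Finset.sum_le_sum fun j _ => ?_)
  rw [norm_smul]
  exact mul_le_mul_of_nonneg_right (hC i j v) (norm_nonneg _)

lemma entry_le_ainf (φ : SchwartzMap V3 ℝ) (v : V3) (i j : Fin 3) :
    |Amat φ v i j| ≤ AinfNorm φ :=
  (entry_le _ i j).trans (le_ciSup (ainf_bdd φ) v)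

lemma rhs_cont {T : ℝ} {f : ℝ → V3 → ℝ} (hf : SmoothRapidSolutionOn (Set.Icc 0 T) f) :
    ContinuousOn (fun q : ℝ × V3 => landauRHS (f q.1) q.2) (Set.Ioo 0 T ×ˢ Set.univ) := by
  have ho : IsOpen (Set.Ioo (0:ℝ) T ×ˢ (Set.univ : Set V3)) := isOpen_Ioo.prod isOpen_univ
  have hs : ContDiffOn ℝ (⊤ : ℕ∞) (fun q : ℝ × V3 => f q.1 q.2) (Set.Ioo 0 T ×ˢ Set.univ) :=
    hf.smooth.mono (Set.prod_mono Set.Ioo_subset_Icc_self le_rfl)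
  have h1 := hs.continuousOn_fderiv_of_isOpen ho (by simp)
  have h2 : ContinuousOn (fun q : ℝ × V3 =>
      fderiv ℝ (fun q : ℝ × V3 => f q.1 q.2) q (1, 0)) (Set.Ioo 0 T ×ˢ Set.univ) :=
    h1.clm_apply continuousOn_const
  refine h2.congr ?_
  rintro ⟨s, v⟩ hq
  have hd : DifferentiableAt ℝ (fun q : ℝ × V3 => f q.1 q.2) (s, v) :=
    (hs.differentiableOn (by simp)).differentiableAt (ho.mem_nhds hq)
  have hsol := hf.solves s (by rw [interior_Icc]; exact hq.1) v
  have hp : HasDerivAt (fun τ : ℝ => ((τ, v) : ℝ × V3)) (1, 0) s :=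
    (hasDerivAt_id s).prodMk (hasDerivAt_const s v)
  have := hd.hasFDerivAt.comp_hasDerivAt s hp
  exact hsol.unique this

lemma time_deriv {T : ℝ} {f : ℝ → V3 → ℝ} (hf : SmoothRapidSolutionOn (Set.Icc 0 T) f)
    (n k : ℝ) {R ε : ℝ} (hR : 1 ≤ R) (hε : 0 < ε) {a a' : ℝ → ℝ}
    (ha : ∀ s ∈ Set.Ioo 0 T, HasDerivAt a (a' s) s) (ha' : ContinuousOn a' (Set.Ioo 0 T))
    {t : ℝ} (ht : t ∈ Set.Ioo 0 T) :
    HasDerivAt (fun s => ∫ v, zt n R v ^ 2 * b0 ε (a s - f s v * jap v ^ k))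
      (∫ v, zt n R v ^ 2 * (b1 ε (a t - f t v * jap v ^ k) *
        (a' t - landauRHS (f t) v * jap v ^ k))) t := by
  set U : Set (ℝ × V3) := Set.Ioo (0:ℝ) T ×ˢ (Set.univ : Set V3) with hU
  set S := tsupport (zt n R) with hS
  have cS : IsCompact S := zt_hcs n hR
  have kz : Continuous (zt n R) := (zt_contDiff n R (m := 0)).continuous
  have kW : Continuous (fun v => jap v ^ k) := (jap_contDiff k (n := 0)).continuous
  have kb1 : Continuous (b1 ε) := by
    have : Differentiable ℝ (b1 ε) := fun x => (b1_deriv hε x).differentiableAt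
    exact this.continuous
  have kb0 : Continuous (b0 ε) := (b0_contDiff hε).continuous
  have kf : ContinuousOn (fun q : ℝ × V3 => f q.1 q.2) U :=
    (hf.smooth.mono (Set.prod_mono Set.Ioo_subset_Icc_self le_rfl)).continuousOn
  have mf : Set.MapsTo (fun q : ℝ × V3 => q.1) U (Set.Ioo 0 T) := fun q hq => hq.1
  have ka : ContinuousOn (fun q : ℝ × V3 => a q.1) U :=
    ContinuousOn.comp (g := a) (fun s hs => (ha s hs).continuousAt.continuousWithinAt)
      continuous_fst.continuousOn mf
  have ka' : ContinuousOn (fun q : ℝ × V3 => a' q.1) U :=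
    ContinuousOn.comp (g := a') ha' continuous_fst.continuousOn mf
  have kz2 : ContinuousOn (fun q : ℝ × V3 => zt n R q.2 ^ 2) U :=
    ((kz.comp continuous_snd).pow 2).continuousOn
  have kW2 : ContinuousOn (fun q : ℝ × V3 => jap q.2 ^ k) U :=
    (kW.comp continuous_snd).continuousOn
  have ku : ContinuousOn (fun q : ℝ × V3 => a q.1 - f q.1 q.2 * jap q.2 ^ k) U :=
    ka.sub (kf.mul kW2)
  have kF : ContinuousOn (fun q : ℝ × V3 => zt n R q.2 ^ 2 *
      b0 ε (a q.1 - f q.1 q.2 * jap q.2 ^ k)) U := kz2.mul (kb0.comp_continuousOn ku)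
  set D : ℝ × V3 → ℝ := fun q => zt n R q.2 ^ 2 * (b1 ε (a q.1 - f q.1 q.2 * jap q.2 ^ k) *
        (a' q.1 - landauRHS (f q.1) q.2 * jap q.2 ^ k)) with hD
  have kD : ContinuousOn D U :=
    kz2.mul ((kb1.comp_continuousOn ku).mul (ka'.sub ((rhs_cont hf).mul kW2)))
  have slice : ∀ {G : ℝ × V3 → ℝ}, ContinuousOn G U → ∀ s ∈ Set.Ioo 0 T,
      Continuous fun v => G (s, v) := by
    intro G hG s hs
    have : Continuous fun v : V3 => ((s, v) : ℝ × V3) := by fun_prop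
    exact hG.comp_continuous this fun v => ⟨hs, Set.mem_univ _⟩
  obtain ⟨δ, hδ, hball⟩ := Metric.nhds_basis_closedBall.mem_iff.1 (isOpen_Ioo.mem_nhds ht)
  have cK : IsCompact (Metric.closedBall t δ ×ˢ S) := (isCompact_closedBall t δ).prod cS
  obtain ⟨C, hC⟩ := cK.exists_bound_of_continuousOn
    (kD.mono (Set.prod_mono hball (Set.subset_univ _)))
  have zt0 : ∀ v, v ∉ S → zt n R v = 0 := fun v hv => image_eq_zero_of_notMem_tsupport hv
  have hcs : ∀ G : V3 → ℝ, HasCompactSupport fun v => zt n R v ^ 2 * G v := fun G => by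
    refine HasCompactSupport.of_support_subset_isCompact cS fun v hv => ?_
    by_contra hc
    apply hv
    simp [zt0 v hc]
  have key := hasDerivAt_integral_of_dominated_loc_of_deriv_le (μ := (volume : Measure V3))
    (F := fun s v => zt n R v ^ 2 * b0 ε (a s - f s v * jap v ^ k))
    (F' := fun s v => D (s, v)) (x₀ := t) (s := Metric.closedBall t δ)
    (bound := S.indicator fun _ => C) (Metric.closedBall_mem_nhds t hδ) ?_ ?_ ?_ ?_ ?_ ?_
  · exact key.2
  · filter_upwards [Metric.closedBall_mem_nhds t hδ] with s hs
    exact (slice kF s (hball hs)).aestronglyMeasurable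
  · exact (slice kF t ht).integrable_of_hasCompactSupport (hcs _)
  · exact (slice kD t ht).aestronglyMeasurable
  · refine Filter.Eventually.of_forall fun v s hs => ?_
    by_cases hv : v ∈ S
    · rw [Set.indicator_of_mem hv]
      exact hC (s, v) ⟨hs, hv⟩
    · rw [Set.indicator_of_notMem hv]
      simp [hD, zt0 v hv]
  · exact (integrable_indicator_iff cS.measurableSet).2 (integrableOn_const cS.measure_lt_top.ne)
  · refine Filter.Eventually.of_forall fun v s hs => ?_
    have hs' := hball hs
    have hsol := hf.solves s (by rw [interior_Icc]; exact hs') v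
    have h1 : HasDerivAt (fun s => a s - f s v * jap v ^ k)
      (a' s - landauRHS (f s) v * jap v ^ k) s := (ha s hs').sub (hsol.mul_const _)
    exact ((b0_deriv hε _).comp s h1).const_mul _

end MPB

namespace MPB

lemma lim_int {n k c : ℝ} (hn : n < -3) (hc : 0 < c) {g : V3 → ℝ} (hg : ∀ v, 0 ≤ g v)
    (cg : Continuous g) :
    Filter.Tendsto (fun m : ℕ => ∫ v, zt n (m + 1) v ^ 2 * b0 (1 / (m + 1)) (c - g v * jap v ^ k))
      Filter.atTop (nhds (∫ v, jap v ^ n * plus (c - g v * jap v ^ k) ^ ((3 : ℝ) / 2))) := by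
  have kW : Continuous (fun v => jap v ^ k) := (jap_contDiff k (n := 0)).continuous
  have ku : Continuous (fun v => c - g v * jap v ^ k) := continuous_const.sub (cg.mul kW)
  have hε : ∀ m : ℕ, (0:ℝ) < 1 / (m + 1) := fun m => by positivity
  refine tendsto_integral_of_dominated_convergence (fun v => jap v ^ n * c ^ ((3 : ℝ) / 2)) ?_
    ((jap_int hn).mul_const _) ?_ ?_
  · intro m
    exact (((zt_contDiff n _ (m := 0)).continuous.pow 2).mul
      ((b0_contDiff (hε m)).continuous.comp ku)).aestronglyMeasurable
  · intro m
    refine Filter.Eventually.of_forall fun v => ?_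
    rw [Real.norm_eq_abs, abs_of_nonneg (mul_nonneg (sq_nonneg _) (b0_nonneg (hε m) _))]
    refine mul_le_mul (by rw [pow_two]; exact zt_sq_le n _ v) ?_ (b0_nonneg (hε m) _)
      (Real.rpow_nonneg (jap_pos v).le _)
    refine (b0_le_rpow (hε m) _).trans ?_
    refine Real.rpow_le_rpow (plus_nonneg _) (max_le ?_ hc.le) (by norm_num)
    have := mul_nonneg (hg v) (Real.rpow_nonneg (jap_pos v).le k)
    linarith
  · refine Filter.Eventually.of_forall fun v => ?_
    refine Filter.Tendsto.mul ?_ (b0_tendsto tendsto_one_div_add_atTop_nhds_zero_nat _)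
    refine tendsto_const_nhds.congr' ?_
    filter_upwards [Filter.eventually_ge_atTop ⌈‖v‖⌉₊] with m hm
    have h1 : ‖v‖ ≤ (m : ℝ) + 1 := by
      have := (Nat.le_ceil ‖v‖).trans (Nat.cast_le.2 hm)
      linarith
    have h2 : (1:ℝ) ≤ (m : ℝ) + 1 := by
      have : (0:ℝ) ≤ m := Nat.cast_nonneg m
      linarith
    unfold zt
    rw [chi_one h2 v h1, mul_one, pow_two, jap_half]

lemma barrier_deriv (a η : ℝ) {s : ℝ} (hs : 0 < s) :
    HasDerivAt (fun s => a * Real.exp (-η * s ^ ((2 : ℝ) / 3)))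
      (a * Real.exp (-η * s ^ ((2 : ℝ) / 3)) * (-η * (2 / 3 * s ^ (-(1 : ℝ) / 3)))) s := by
  have h1 : HasDerivAt (fun s : ℝ => s ^ ((2 : ℝ) / 3)) (2 / 3 * s ^ ((2 : ℝ) / 3 - 1)) s :=
    Real.hasDerivAt_rpow_const (Or.inl hs.ne')
  rw [show ((2 : ℝ) / 3 - 1) = -(1 : ℝ) / 3 by norm_num] at h1
  exact (((h1.const_mul (-η)).exp).const_mul a).congr_deriv (by ring)

end MPB

/-- minimum principle barrier. -/
theorem minimum_principle_barrier
    (k : ℝ) (hk : 0 < k) :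
    ∃ n₀ : ℝ, n₀ < -3 ∧
      ∀ M : ℝ, 0 < M → ∀ n : ℝ, n ≤ n₀ →
        ∃ η : ℝ, 0 < η ∧
          ∀ a : ℝ, 0 < a →
          ∀ (T : ℝ) (f : ℝ → V3 → ℝ), SmoothRapidSolutionOn (Set.Icc 0 T) f →
            (∀ t : ℝ, 0 < t → t ≤ T → AinfNorm (f t) ≤ M * t ^ (-(1 : ℝ) / 3)) →
            ∀ t ∈ Set.Ioo (0 : ℝ) T,
              deriv (fun s => ∫ v : V3, jap v ^ n *
                plus (a * Real.exp (-η * s ^ ((2 : ℝ) / 3)) - f s v * jap v ^ k) ^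
                  ((3 : ℝ) / 2)) t ≤ 0 := by
  refine ⟨-4, by norm_num, fun M hM n hn => ?_⟩
  have hn3 : n < -3 := by linarith
  obtain ⟨K, hK, hspat⟩ := MPB.spatial n k hn3 hk
  refine ⟨3 * K * M + 1, by positivity, fun a ha T f hf hA t ht => ?_⟩
  set η := 3 * K * M + 1 with hη
  have hη0 : 0 < η := by positivity
  set b : ℝ → ℝ := fun s => a * Real.exp (-η * s ^ ((2 : ℝ) / 3)) with hb
  set b' : ℝ → ℝ := fun s => b s * (-η * (2 / 3 * s ^ (-(1 : ℝ) / 3))) with hb'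
  have hbd : ∀ s ∈ Set.Ioo 0 T, HasDerivAt b (b' s) s := fun s hs => MPB.barrier_deriv a η hs.1
  have hbc : ContinuousOn b' (Set.Ioo 0 T) := by
    refine ContinuousOn.mul (fun s hs => (hbd s hs).continuousAt.continuousWithinAt) ?_
    refine continuousOn_const.mul (continuousOn_const.mul ?_)
    exact ContinuousOn.rpow_const continuousOn_id fun s hs => Or.inl hs.1.ne'
  have hbpos : ∀ s, 0 < b s := fun s => by positivity
  have hble : ∀ s, 0 < s → b s ≤ a := by
    intro s hs
    have : Real.exp (-η * s ^ ((2 : ℝ) / 3)) ≤ 1 := by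
      rw [Real.exp_le_one_iff]
      have : 0 ≤ η * s ^ ((2 : ℝ) / 3) := by positivity
      linarith
    exact mul_le_of_le_one_right ha.le this
  have hsch : ∀ s ∈ Set.Ioo 0 T, ∃ φ : SchwartzMap V3 ℝ, f s = φ := fun s hs => by
    obtain ⟨φ, h⟩ := hf.schwartz s (Set.Ioo_subset_Icc_self hs)
    exact ⟨φ, funext h⟩
  have hnn : ∀ s ∈ Set.Ioo 0 T, ∀ v, 0 ≤ f s v := fun s hs => hf.nonneg s (Set.Ioo_subset_Icc_self hs)
  set I := ∫ v, jap v ^ n with hI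
  have hI0 : 0 ≤ I := integral_nonneg fun v => Real.rpow_nonneg (MPB.jap_pos v).le _
  have hder : ∀ s ∈ Set.Ioo 0 T, ∀ R, 1 ≤ R → ∀ ε, 0 < ε →
      ∫ v, MPB.zt n R v ^ 2 * (MPB.b1 ε (b s - f s v * jap v ^ k) *
        (b' s - landauRHS (f s) v * jap v ^ k)) ≤
      3 * a ^ (1 / 2 : ℝ) * (2 * K * (a * (M * s ^ (-(1 : ℝ) / 3)))) * R⁻¹ ^ 2 * I := by
    intro s hs R hR ε hε
    obtain ⟨φ, hφ⟩ := hsch s hs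
    have hφ0 : ∀ w, 0 ≤ φ w := fun w => by rw [← hφ]; exact hnn s hs w
    have H := MPB.good_of_schwartz φ hφ0
    have cφ : ContDiff ℝ 2 φ := φ.smooth 2
    have hs1 : 0 < s ^ (-(1 : ℝ) / 3) := Real.rpow_pos_of_pos hs.1 _
    have hN : ∀ v i j, |Amat φ v i j| ≤ M * s ^ (-(1 : ℝ) / 3) := fun v i j => by
      have h2 := hA s hs.1 hs.2.le
      rw [hφ] at h2
      exact (MPB.entry_le_ainf φ v i j).trans h2
    have h1 := hspat (Amat φ) (apot φ) φ H cφ hφ0 _ hN R hR ε hε (b s) (hbpos s) (b' s) (by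
      have : 0 ≤ b s * s ^ (-(1 : ℝ) / 3) := mul_nonneg (hbpos s).le hs1.le
      simp only [hb', hη]
      linarith)
    have h2 : ∀ v, landauRHS (f s) v =
        MPB.ct (Amat φ v) (fun i j => pd i (pd j φ) v) - φ v * ∑ i, pd i (pd i (apot φ)) v := by
      intro v
      rw [hφ]
      exact MPB.landau_expand H cφ v
    simp only [h2]
    rw [hφ]
    refine h1.trans ?_
    have R0 : 0 < R⁻¹ := by positivity
    have h3 : (b s) ^ (1 / 2 : ℝ) ≤ a ^ (1 / 2 : ℝ) :=
      Real.rpow_le_rpow (hbpos s).le (hble s hs.1) (by norm_num)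
    have h4 := hble s hs.1
    have h5 := hbpos s
    gcongr
  have anti : AntitoneOn (fun s => ∫ v : V3, jap v ^ n *
      plus (b s - f s v * jap v ^ k) ^ ((3 : ℝ) / 2)) (Set.Ioo 0 T) := by
    intro s₁ h₁ s₂ h₂ h12
    have lim : ∀ s ∈ Set.Ioo 0 T, _ := fun s hs =>
      MPB.lim_int (k := k) hn3 (hbpos s) (hnn s hs) (by
        obtain ⟨φ, hφ⟩ := hsch s hs
        rw [hφ]; exact φ.continuous)
    set B := 3 * a ^ (1 / 2 : ℝ) * (2 * K * (a * (M * s₁ ^ (-(1 : ℝ) / 3)))) * I with hB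
    have hmv : ∀ m : ℕ, (∫ v, MPB.zt n (m + 1) v ^ 2 * MPB.b0 (1 / (m + 1)) (b s₂ - f s₂ v * jap v ^ k))
        ≤ (∫ v, MPB.zt n (m + 1) v ^ 2 * MPB.b0 (1 / (m + 1)) (b s₁ - f s₁ v * jap v ^ k)) +
          B * (1 / ((m : ℝ) + 1)) ^ 2 * (s₂ - s₁) := by
      intro m
      have hR : (1:ℝ) ≤ (m : ℝ) + 1 := by
        have : (0:ℝ) ≤ m := Nat.cast_nonneg m
        linarith
      have hε : (0:ℝ) < 1 / ((m : ℝ) + 1) := by positivity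
      have sub : ∀ s ∈ Set.Icc s₁ s₂, s ∈ Set.Ioo 0 T := fun s hs =>
        ⟨h₁.1.trans_le hs.1, hs.2.trans_lt h₂.2⟩
      have td : ∀ s ∈ Set.Icc s₁ s₂, _ := fun s hs =>
        MPB.time_deriv hf n k hR hε hbd hbc (sub s hs)
      have := (convex_Icc s₁ s₂).image_sub_le_mul_sub_of_deriv_le
        (f := fun s => ∫ v, MPB.zt n (m + 1) v ^ 2 * MPB.b0 (1 / (m + 1)) (b s - f s v * jap v ^ k))
        (C := B * (1 / ((m : ℝ) + 1)) ^ 2)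
        (fun s hs => (td s hs).continuousAt.continuousWithinAt)
        (fun s hs => (td s (interior_subset hs)).differentiableAt.differentiableWithinAt) ?_
        s₁ (Set.left_mem_Icc.2 h12) s₂ (Set.right_mem_Icc.2 h12) h12
      · linarith
      · intro s hs
        have hs' := interior_subset hs
        rw [(td s hs').deriv]
        refine (hder s (sub s hs') _ hR _ hε).trans ?_
        have e : s ^ (-(1 : ℝ) / 3) ≤ s₁ ^ (-(1 : ℝ) / 3) :=
          Real.rpow_le_rpow_of_nonpos h₁.1 hs'.1 (by norm_num)
        calc _ ≤ 3 * a ^ (1 / 2 : ℝ) * (2 * K * (a * (M * s₁ ^ (-(1 : ℝ) / 3)))) *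
              ((m : ℝ) + 1)⁻¹ ^ 2 * I := by gcongr
          _ = _ := by rw [hB, one_div]; ring
    have l2 : Filter.Tendsto (fun m : ℕ => B * (1 / ((m : ℝ) + 1)) ^ 2 * (s₂ - s₁)) Filter.atTop
        (nhds (B * 0 ^ 2 * (s₂ - s₁))) :=
      ((tendsto_one_div_add_atTop_nhds_zero_nat.pow 2).const_mul B).mul_const _
    have := le_of_tendsto_of_tendsto' (lim s₂ h₂) ((lim s₁ h₁).add l2) hmv
    simpa using this
  have h := anti.derivWithin_nonpos (x := t)
  rwa [derivWithin_of_isOpen isOpen_Ioo ht] at h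
end
end

section
/- (Weighted Sobolev inequality) For each k ≥ 3 there exist constants C₁ = C₁(k) > 0 and C₂ = C₂(k) > 0 such that for every Schwartz function f : ℝ³ → ℝ: ( ∫_{ℝ³} ⟨v⟩^{3k−9} f(v)^6 dv )^{1/3} + C₁ ∫_{ℝ³} ⟨v⟩^{k−5} f(v)² dv ≤ C₂ ∫_{ℝ³} ⟨v⟩^{k−3} |∇f(v)|² dv. -/
open MeasureTheory Real
noncomputable section

open Filter Topology ENNReal in
lemma sobolev_eLp (g : SchwartzMap V3 ℝ) :
    eLpNorm g 6 volume ≤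
      SNormLESNormFDerivOfEqConst ℝ (volume : Measure V3) 2 * eLpNorm (fderiv ℝ g) 2 volume := by
  let χ : ContDiffBump (0 : V3) := ⟨1, 2, by norm_num, by norm_num⟩
  have hχ : ContDiff ℝ 1 χ := χ.contDiff
  obtain ⟨M, hM⟩ : ∃ M, ∀ x, ‖fderiv ℝ χ x‖ ≤ M :=
    (hχ.continuous_fderiv one_ne_zero).bounded_above_of_compact_support
      (χ.hasCompactSupport.fderiv (𝕜 := ℝ))
  have hM0 : 0 ≤ M := (norm_nonneg _).trans (hM 0)
  have hg1 : ContDiff ℝ 1 g := g.smooth 1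
  let c : ℕ → ℝ := fun n => 1 / ((n : ℝ) + 1)
  have hc : ∀ n, 0 < c n := fun n => by positivity
  have hct : Tendsto c atTop (𝓝 0) := tendsto_one_div_add_atTop_nhds_zero_nat
  let u : ℕ → V3 → ℝ := fun n x => χ (c n • x) * g x
  have hu1 : ∀ n, ContDiff ℝ 1 (u n) := fun n =>
    (hχ.comp (contDiff_const_smul (c n))).mul hg1
  have hu2 : ∀ n, HasCompactSupport (u n) := fun n =>
    (χ.hasCompactSupport.comp_smul (hc n).ne').mul_right
  have hlim : eLpNorm g 6 volume ≤ liminf (fun n => eLpNorm (u n) 6 volume) atTop := by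
    apply Lp.eLpNorm_lim_le_liminf_eLpNorm
    · intro n; exact (hu1 n).continuous.aestronglyMeasurable
    · refine Eventually.of_forall fun x => ?_
      have h1 : Tendsto (fun n => χ (c n • x)) atTop (𝓝 (χ ((0:ℝ) • x))) :=
        (χ.continuous.tendsto _).comp (hct.smul_const x)
      have h2 : χ ((0:ℝ) • x) = 1 := by
        rw [zero_smul]; exact χ.one_of_mem_closedBall (by simp [χ])
      rw [h2] at h1
      simpa using h1.mul_const (g x)
  have hbd : ∀ n x, ‖fderiv ℝ (u n) x‖ ≤ ‖fderiv ℝ g x‖ + (c n * M) * ‖g x‖ := by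
    intro n x
    have hd1 : HasFDerivAt (fun x : V3 => χ (c n • x))
        ((fderiv ℝ χ (c n • x)).comp (c n • ContinuousLinearMap.id ℝ V3)) x := by
      have := ((hχ.differentiable one_ne_zero) (c n • x)).hasFDerivAt.comp x
        ((hasFDerivAt_id (𝕜 := ℝ) x).const_smul (c n))
      exact this
    have hd := hd1.mul (hg1.differentiable one_ne_zero x).hasFDerivAt
    have := hd.fderiv
    change fderiv ℝ (u n) x = _ at this
    rw [this]
    refine (norm_add_le _ _).trans ?_
    rw [norm_smul, norm_smul]
    have e1 : ‖χ (c n • x)‖ ≤ 1 := by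
      rw [Real.norm_of_nonneg χ.nonneg]; exact χ.le_one
    have e2 : ‖(fderiv ℝ χ (c n • x)).comp (c n • ContinuousLinearMap.id ℝ V3)‖ ≤ c n * M := by
      rw [ContinuousLinearMap.comp_smul, norm_smul, Real.norm_of_nonneg (hc n).le,
        ContinuousLinearMap.comp_id]
      exact mul_le_mul_of_nonneg_left (hM _) (hc n).le
    have := mul_le_mul_of_nonneg_right e1 (norm_nonneg (fderiv ℝ g x))
    have := mul_le_mul_of_nonneg_left e2 (norm_nonneg (g x))
    linarith
  set K : ℝ≥0∞ := ((SNormLESNormFDerivOfEqConst ℝ (volume : Measure V3) 2 : NNReal) : ℝ≥0∞)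
  have hn : ∀ n, eLpNorm (u n) 6 volume ≤
      K * (eLpNorm (fderiv ℝ g) 2 volume + ENNReal.ofReal (c n * M) * eLpNorm g 2 volume) := by
    intro n
    have hs := eLpNorm_le_eLpNorm_fderiv_of_eq (volume : Measure V3) (hu1 n) (hu2 n)
      (p := 2) (p' := 6) (by norm_num) (by simp) (by simp; norm_num)
    refine (le_of_eq_of_le (by norm_num) hs).trans ?_
    have : (((2 : NNReal) : NNReal) : ℝ≥0∞) = 2 := by norm_num
    rw [this]
    refine mul_le_mul' (le_of_eq (by simp [K])) ?_
    have hmD : AEStronglyMeasurable (fun x => ‖fderiv ℝ g x‖) (volume : Measure V3) :=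
      (hg1.continuous_fderiv one_ne_zero).norm.aestronglyMeasurable
    have hmg : AEStronglyMeasurable (fun x => (c n * M) * ‖g x‖) (volume : Measure V3) :=
      (continuous_const.mul g.continuous.norm).aestronglyMeasurable
    calc eLpNorm (fderiv ℝ (u n)) 2 volume
        ≤ eLpNorm ((fun x => ‖fderiv ℝ g x‖) + (fun x => (c n * M) * ‖g x‖)) 2 volume :=
          eLpNorm_mono_real (hbd n)
      _ ≤ eLpNorm (fun x => ‖fderiv ℝ g x‖) 2 volume
            + eLpNorm (fun x => (c n * M) * ‖g x‖) 2 volume :=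
          eLpNorm_add_le hmD hmg (by norm_num)
      _ = _ := by
          rw [eLpNorm_norm]
          congr 1
          have := eLpNorm_const_smul (c n * M) (fun x => ‖g x‖) 2 (volume : Measure V3)
          rw [eLpNorm_norm, Real.enorm_of_nonneg (mul_nonneg (hc n).le hM0)] at this
          exact this
  have hK : K ≠ ⊤ := ENNReal.coe_ne_top
  clear_value K
  have hB : eLpNorm g 2 volume ≠ ⊤ := (g.memLp 2 volume).eLpNorm_ne_top
  have hT : Tendsto (fun n => K * (eLpNorm (fderiv ℝ g) 2 volume
      + ENNReal.ofReal (c n * M) * eLpNorm g 2 volume)) atTop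
      (𝓝 (K * eLpNorm (fderiv ℝ g) 2 volume)) := by
    have h0 : Tendsto (fun n => ENNReal.ofReal (c n * M)) atTop (𝓝 0) := by
      have := ENNReal.tendsto_ofReal (hct.mul_const M)
      simpa using this
    have h1 := ENNReal.Tendsto.mul_const h0 (b := eLpNorm g 2 volume)
      (Or.inr hB)
    have h2 := (tendsto_const_nhds (x := eLpNorm (fderiv ℝ g) 2 volume)).add h1
    have h3 := ENNReal.Tendsto.const_mul (a := K) h2 (Or.inr hK)
    simpa only [zero_mul, add_zero] using h3
  exact hlim.trans ((liminf_le_liminf (Eventually.of_forall hn)).trans hT.liminf_eq.le)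

lemma sobolev_real : ∃ C : ℝ, 0 ≤ C ∧ ∀ g : SchwartzMap V3 ℝ,
    (∫ v, g v ^ 6) ^ ((1:ℝ)/3) ≤ C * ∫ v, ‖fderiv ℝ g v‖ ^ 2 := by
  refine ⟨(SNormLESNormFDerivOfEqConst ℝ (volume : Measure V3) 2 : ℝ) ^ 2, by positivity, ?_⟩
  intro g
  have h := sobolev_eLp g
  have hD : MemLp (fderiv ℝ g) 2 (volume : Measure V3) :=
    (SchwartzMap.fderivCLM ℝ V3 ℝ g).memLp 2 volume
  rw [(g.memLp 6 volume).eLpNorm_eq_integral_rpow_norm (by norm_num) (by norm_num),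
    hD.eLpNorm_eq_integral_rpow_norm (by norm_num) (by norm_num)] at h
  have h6 : (6 : ENNReal).toReal = 6 := by norm_num
  have h2 : (2 : ENNReal).toReal = 2 := by norm_num
  rw [h6, h2, ← ENNReal.ofReal_coe_nnreal, ← ENNReal.ofReal_mul (by positivity),
    ENNReal.ofReal_le_ofReal_iff (by positivity)] at h
  have e6 : ∀ v, ‖g v‖ ^ (6:ℝ) = g v ^ 6 := fun v => by
    rw [show (6:ℝ) = ((6:ℕ):ℝ) by norm_num, Real.rpow_natCast, Real.norm_eq_abs,
      Even.pow_abs (by decide)]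
  have e2 : ∀ v, ‖fderiv ℝ g v‖ ^ (2:ℝ) = ‖fderiv ℝ g v‖ ^ 2 := fun v => by
    rw [show (2:ℝ) = ((2:ℕ):ℝ) by norm_num, Real.rpow_natCast]
  simp_rw [e6, e2] at h
  have p6 : 0 ≤ ∫ v, g v ^ 6 := integral_nonneg fun v => by positivity
  have p2 : 0 ≤ ∫ v, ‖fderiv ℝ g v‖ ^ 2 := integral_nonneg fun v => by positivity
  have h' := pow_le_pow_left₀ (by positivity) h 2
  rw [mul_pow, ← Real.rpow_natCast, ← Real.rpow_mul p6, ← Real.rpow_natCast (_ ^ _) 2,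
    ← Real.rpow_mul p2] at h'
  norm_num at h' ⊢
  exact h'

lemma jap_pos (v : V3) : 0 < jap v := Real.sqrt_pos.2 (by positivity)

lemma jap_sq (v : V3) : jap v ^ 2 = 1 + ‖v‖ ^ 2 := Real.sq_sqrt (by positivity)

lemma norm_le_jap (v : V3) : ‖v‖ ≤ jap v :=
  Real.le_sqrt_of_sq_le (by linarith)

lemma jap_rpow (r : ℝ) (v : V3) : jap v ^ r = (1 + ‖v‖ ^ 2) ^ (r / 2) := by
  rw [jap, Real.sqrt_eq_rpow, ← Real.rpow_mul (by positivity)]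
  congr 1; ring

lemma jap_tg (r : ℝ) : (fun v : V3 => jap v ^ r).HasTemperateGrowth := by
  simp_rw [jap_rpow]
  fun_prop

lemma jap_hasFDerivAt (r : ℝ) (v : V3) :
    HasFDerivAt (fun v : V3 => jap v ^ r) ((r * jap v ^ (r - 2)) • innerSL ℝ v) v := by
  have h1 : HasFDerivAt (fun v : V3 => 1 + ‖v‖ ^ 2) (2 • innerSL ℝ v) v :=
    (hasStrictFDerivAt_norm_sq v).hasFDerivAt.const_add 1
  have h2 := h1.rpow_const (p := r / 2) (Or.inl (by positivity))
  have e : (fun v : V3 => jap v ^ r) = fun v : V3 => (1 + ‖v‖ ^ 2) ^ (r / 2) := by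
    funext v; exact jap_rpow r v
  rw [e, jap_rpow, show (r - 2) / 2 = r / 2 - 1 by ring]
  have h3 : (r * (1 + ‖v‖ ^ 2) ^ (r / 2 - 1)) • innerSL ℝ v
      = (r / 2 * (1 + ‖v‖ ^ 2) ^ (r / 2 - 1)) • 2 • innerSL ℝ v := by
    rw [← Nat.cast_smul_eq_nsmul ℝ, smul_smul]
    congr 1
    push_cast
    ring
  rw [h3]
  exact h2

lemma jap_mul_rpow (v : V3) (a b : ℝ) : jap v ^ a * jap v ^ b = jap v ^ (a + b) :=
  (Real.rpow_add (jap_pos v) a b).symm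

lemma jap_integrable {F : Type*} [NormedAddCommGroup F] [NormedSpace ℝ F] (r : ℝ)
    (f : SchwartzMap V3 F) : Integrable (fun v => jap v ^ r * ‖f v‖ ^ 2) volume := by
  have h := ((SchwartzMap.smulLeftCLM F (fun v : V3 => jap v ^ (r / 2))) f).memLp 2 volume
  have h2 := h.integrable_norm_pow (by norm_num)
  refine h2.congr (Filter.Eventually.of_forall fun v => ?_)
  beta_reduce
  rw [SchwartzMap.smulLeftCLM_apply_apply (jap_tg _), norm_smul, mul_pow,
    Real.norm_of_nonneg (Real.rpow_nonneg (jap_pos v).le _), pow_two, jap_mul_rpow]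
  norm_num

lemma hardy (s : ℝ) (hs : 0 ≤ s) (f : SchwartzMap V3 ℝ) :
    ∫ v, jap v ^ (s - 2) * f v ^ 2 ≤ 4 * ∫ v, jap v ^ s * ‖fderiv ℝ f v‖ ^ 2 := by
  let e : Fin 3 → V3 := fun i => EuclideanSpace.single i 1
  let a : Fin 3 → V3 → ℝ := fun i v => jap v ^ (s - 2) * v i
  have ha : ∀ i, (a i).HasTemperateGrowth := fun i =>
    (jap_tg (s - 2)).mul
      ((EuclideanSpace.proj i : V3 →L[ℝ] ℝ).hasTemperateGrowth)
  let G : Fin 3 → SchwartzMap V3 ℝ := fun i => SchwartzMap.smulLeftCLM ℝ (a i) f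
  have hG : ∀ i v, G i v = a i v * f v := fun i v =>
    SchwartzMap.smulLeftCLM_apply_apply (ha i) f v
  have hda : ∀ i v, HasFDerivAt (a i) (jap v ^ (s - 2) • (EuclideanSpace.proj i : V3 →L[ℝ] ℝ)
      + v i • (((s - 2) * jap v ^ (s - 2 - 2)) • innerSL ℝ v)) v := fun i v =>
    (jap_hasFDerivAt (s - 2) v).mul (EuclideanSpace.proj i : V3 →L[ℝ] ℝ).hasFDerivAt
  have hdG : ∀ i v, fderiv ℝ (G i) v (e i) = a i v * fderiv ℝ f v (e i) +
      f v * (jap v ^ (s - 2) + (s - 2) * jap v ^ (s - 2 - 2) * (v i) ^ 2) := by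
    intro i v
    have h1 := ((hda i v).mul (f.hasFDerivAt v)).fderiv
    have h2 : (G i : V3 → ℝ) = a i * f := by funext v; exact hG i v
    rw [h2, h1]
    simp [e, EuclideanSpace.inner_single_right]
    ring
  have hi1 : ∀ i, Integrable (fun v => f v * fderiv ℝ (G i) v (e i)) volume := fun i =>
    (SchwartzMap.pairing (ContinuousLinearMap.mul ℝ ℝ) f
      (SchwartzMap.evalCLM ℝ V3 ℝ (e i) (SchwartzMap.fderivCLM ℝ V3 ℝ (G i)))).integrable
  have hi2 : ∀ i, Integrable (fun v => fderiv ℝ f v (e i) * G i v) volume := fun i =>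
    (SchwartzMap.pairing (ContinuousLinearMap.mul ℝ ℝ)
      (SchwartzMap.evalCLM ℝ V3 ℝ (e i) (SchwartzMap.fderivCLM ℝ V3 ℝ f)) (G i)).integrable
  have hibp : ∀ i, ∫ v, (f v * fderiv ℝ (G i) v (e i) + fderiv ℝ f v (e i) * G i v) = 0 := by
    intro i
    rw [integral_add (hi1 i) (hi2 i)]
    have := SchwartzMap.integral_mul_lineDerivOp_right_eq_neg_left (μ := volume) f (G i) (e i)
    simp only [SchwartzMap.lineDerivOp_apply_eq_fderiv] at this
    linarith
  have hi12 : ∀ i, Integrable (fun v => f v * fderiv ℝ (G i) v (e i)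
      + fderiv ℝ f v (e i) * G i v) volume := fun i => (hi1 i).add (hi2 i)
  have hsum : ∫ v, ∑ i, (f v * fderiv ℝ (G i) v (e i) + fderiv ℝ f v (e i) * G i v) = 0 := by
    rw [integral_finsetSum _ (fun i _ => hi12 i)]
    exact Finset.sum_eq_zero fun i _ => hibp i
  have hA : Integrable (fun v => jap v ^ (s - 2) * f v ^ 2) volume := by
    simpa using jap_integrable (s - 2) f
  have hB : Integrable (fun v => jap v ^ s * ‖fderiv ℝ f v‖ ^ 2) volume :=
    jap_integrable s (SchwartzMap.fderivCLM ℝ V3 ℝ f)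
  have hpt : ∀ v, 1 / 2 * (jap v ^ (s - 2) * f v ^ 2) - 2 * (jap v ^ s * ‖fderiv ℝ f v‖ ^ 2)
      ≤ ∑ i, (f v * fderiv ℝ (G i) v (e i) + fderiv ℝ f v (e i) * G i v) := by
    intro v
    have hv : v = ∑ i, v i • e i := by
      ext j; fin_cases j <;> simp [e, Fin.sum_univ_three]
    have hDv : fderiv ℝ f v v = ∑ i, v i * fderiv ℝ f v (e i) := by
      have := congrArg (fderiv ℝ f v) hv
      rw [map_sum] at this
      simpa only [map_smul, smul_eq_mul] using this
    have hn : ‖v‖ ^ 2 = ∑ i, v i ^ 2 := by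
      rw [EuclideanSpace.norm_sq_eq]; simp
    have heq : ∑ i, (f v * fderiv ℝ (G i) v (e i) + fderiv ℝ f v (e i) * G i v) =
        f v ^ 2 * (3 * jap v ^ (s - 2) + (s - 2) * jap v ^ (s - 2 - 2) * ‖v‖ ^ 2)
        + 2 * f v * jap v ^ (s - 2) * fderiv ℝ f v v := by
      rw [hDv, hn]
      simp only [Fin.sum_univ_three, hdG, hG, a]
      ring
    rw [heq]
    have hj := jap_pos v
    set p := jap v ^ (s - 2 - 2)
    have hp : 0 < p := Real.rpow_pos_of_pos hj _
    have e1 : jap v ^ (s - 2) = p * jap v ^ 2 := by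
      rw [← Real.rpow_natCast, jap_mul_rpow]; congr 1; push_cast; ring
    have e2 : jap v ^ s = p * jap v ^ 4 := by
      rw [← Real.rpow_natCast, jap_mul_rpow]; congr 1; push_cast; ring
    have hd : |fderiv ℝ f v v| ≤ ‖fderiv ℝ f v‖ * jap v :=
      ((fderiv ℝ f v).le_opNorm v).trans
        (mul_le_mul_of_nonneg_left (norm_le_jap v) (norm_nonneg _))
    rw [e1, e2]
    have hjs := jap_sq v
    set x := f v
    set d := fderiv ℝ f v v
    set N := ‖fderiv ℝ f v‖
    set J := jap v
    have hd2 : d ^ 2 ≤ N ^ 2 * J ^ 2 := by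
      rw [← sq_abs, ← mul_pow]; exact pow_le_pow_left₀ (abs_nonneg _) hd 2
    have k1 : 0 ≤ p * J ^ 2 * (N ^ 2 * J ^ 2 - d ^ 2) :=
      mul_nonneg (by positivity) (by linarith)
    have k2 : 0 ≤ p * J ^ 2 * (x + 2 * d) ^ 2 := by positivity
    have k3 : 0 ≤ p * x ^ 2 * (2 + s * ‖v‖ ^ 2) := by positivity
    have hn2 : ‖v‖ ^ 2 = J ^ 2 - 1 := by linarith
    rw [hn2] at k3 ⊢
    nlinarith [k1, k2, k3]
  have hint : Integrable (fun v => 1 / 2 * (jap v ^ (s - 2) * f v ^ 2)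
      - 2 * (jap v ^ s * ‖fderiv ℝ f v‖ ^ 2)) volume := (hA.const_mul _).sub (hB.const_mul _)
  have := integral_mono hint (integrable_finsetSum _ fun i _ => hi12 i) hpt
  rw [hsum, integral_sub (hA.const_mul _) (hB.const_mul _), integral_const_mul,
    integral_const_mul] at this
  linarith

/-- weighted Sobolev inequality. -/
theorem weighted_sobolev_inequality
    (k : ℝ) (hk : 3 ≤ k) :
    ∃ C₁ C₂ : ℝ, 0 < C₁ ∧ 0 < C₂ ∧
      ∀ f : SchwartzMap V3 ℝ,
        (∫ v : V3, jap v ^ (3 * k - 9) * f v ^ 6) ^ ((1 : ℝ) / 3) +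
          C₁ * (∫ v : V3, jap v ^ (k - 5) * f v ^ 2) ≤
        C₂ * ∫ v : V3, jap v ^ (k - 3) * ‖gradient (⇑f) v‖ ^ 2 := by
  obtain ⟨C, hC, hS⟩ := sobolev_real
  obtain ⟨s, rfl⟩ : ∃ s, k = s + 3 := ⟨k - 3, by ring⟩
  have hs : 0 ≤ s := by linarith
  refine ⟨1, C * (2 + 2 * s ^ 2) + 4, one_pos, by positivity, fun f => ?_⟩
  have hgr : ∀ v, ‖gradient (⇑f) v‖ = ‖fderiv ℝ f v‖ := fun v => by
    rw [gradient, LinearIsometryEquiv.norm_map]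
  simp_rw [hgr]
  rw [show s + 3 - 5 = s - 2 by ring, show s + 3 - 3 = s by ring,
    show 3 * (s + 3) - 9 = 3 * s by ring]
  have hH := hardy s hs f
  let g := SchwartzMap.smulLeftCLM ℝ (fun v : V3 => jap v ^ (s / 2)) f
  have hg : ∀ v, g v = jap v ^ (s / 2) * f v := fun v =>
    SchwartzMap.smulLeftCLM_apply_apply (jap_tg _) f v
  have hSg := hS g
  have h6 : ∀ v, g v ^ 6 = jap v ^ (3 * s) * f v ^ 6 := fun v => by
    rw [hg, mul_pow, ← Real.rpow_natCast, ← Real.rpow_mul (jap_pos v).le]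
    congr 2; push_cast; ring
  simp_rw [h6] at hSg
  have hA : Integrable (fun v => jap v ^ (s - 2) * f v ^ 2) volume := by
    simpa using jap_integrable (s - 2) f
  have hB : Integrable (fun v => jap v ^ s * ‖fderiv ℝ f v‖ ^ 2) volume :=
    jap_integrable s (SchwartzMap.fderivCLM ℝ V3 ℝ f)
  have hD : Integrable (fun v => ‖fderiv ℝ g v‖ ^ 2) volume := by
    simpa using jap_integrable 0 (SchwartzMap.fderivCLM ℝ V3 ℝ g)
  have hpt : ∀ v, ‖fderiv ℝ g v‖ ^ 2 ≤ 2 * (jap v ^ s * ‖fderiv ℝ f v‖ ^ 2)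
      + s ^ 2 / 2 * (jap v ^ (s - 2) * f v ^ 2) := by
    intro v
    have hj := jap_pos v
    have h1 := ((jap_hasFDerivAt (s / 2) v).mul (f.hasFDerivAt v)).fderiv
    have h2 : (g : V3 → ℝ) = (fun v => jap v ^ (s / 2)) * f := by funext v; exact hg v
    set q := jap v ^ (s / 2 - 2)
    have hq : 0 < q := Real.rpow_pos_of_pos hj _
    have e0 : jap v ^ (s / 2) = q * jap v ^ 2 := by
      rw [← Real.rpow_natCast, jap_mul_rpow]; congr 1; push_cast; ring
    have e1 : jap v ^ (s - 2) = q ^ 2 * jap v ^ 2 := by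
      rw [pow_two q, ← Real.rpow_natCast, jap_mul_rpow, jap_mul_rpow]
      congr 1; push_cast; ring
    have e2 : jap v ^ s = q ^ 2 * jap v ^ 4 := by
      rw [pow_two q, ← Real.rpow_natCast, jap_mul_rpow, jap_mul_rpow]
      congr 1; push_cast; ring
    have hb : ‖fderiv ℝ g v‖ ≤ q * jap v ^ 2 * ‖fderiv ℝ f v‖ + |f v| * (s / 2 * q * jap v) := by
      rw [h2, h1]
      refine (norm_add_le _ _).trans ?_
      rw [norm_smul, norm_smul, norm_smul, innerSL_apply_norm, e0,
        Real.norm_of_nonneg (by positivity), Real.norm_eq_abs,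
        Real.norm_of_nonneg (by positivity : 0 ≤ s / 2 * q)]
      gcongr
      exact norm_le_jap v
    rw [e1, e2]
    refine (pow_le_pow_left₀ (norm_nonneg _) hb 2).trans ?_
    refine (add_sq_le).trans (le_of_eq ?_)
    rw [mul_pow |f v|, sq_abs]
    ring
  have hI := integral_mono hD ((hB.const_mul 2).add (hA.const_mul (s ^ 2 / 2))) hpt
  simp only [Pi.add_apply] at hI
  rw [integral_add (hB.const_mul _) (hA.const_mul _), integral_const_mul,
    integral_const_mul] at hI
  have h3 := mul_le_mul_of_nonneg_left hI hC
  have h4 := mul_le_mul_of_nonneg_left hH (by positivity : 0 ≤ C * (s ^ 2 / 2))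
  nlinarith [h3, h4, hSg, hH]
end
end
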